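/- Let α be a 3-CNF formula with m clauses, each clause having exactly three literals and each variable appearing at most once per clause, and let G_α be the associated graph. If α is satisfiable, then G_α admits a strong 1-rounding. -/

import Mathlib

open SimpleGraph

/-! ## Generic shortest-path and rounding definitions -/

noncomputable def wWeight {V : Type*} {G : SimpleGraph V} (w : V → V → ℝ) {u v : V}
    (p : G.Walk u v) : ℝ :=
  (p.darts.map (fun d => w d.toProd.1 d.toProd.2)).sum

def IsShortestPath {V : Type*} {G : SimpleGraph V} (w : V → V → ℝ) {u v : V}
    (p : G.Walk u v) : Prop :=
  p.IsPath ∧ ∀ q : G.Walk u v, wWeight w p ≤ wWeight w q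

def PathObliviousRounding {V : Type*} (G : SimpleGraph V) (w : V → V → ℝ) (wt : V → V → ℕ)
    (ε : ℝ) : Prop :=
  ∀ (u v : V) (p : G.Walk u v), IsShortestPath w p →
    |wWeight (fun a b => (wt a b : ℝ)) p - wWeight w p| < ε

def WeakRounding {V : Type*} (G : SimpleGraph V) (w : V → V → ℝ) (wt : V → V → ℕ)
    (ε : ℝ) : Prop :=
  PathObliviousRounding G w wt ε ∧
  ∀ (u v : V) (p : G.Walk u v), IsShortestPath w p →
    IsShortestPath (fun a b => (wt a b : ℝ)) p

def StrongRounding {V : Type*} (G : SimpleGraph V) (w : V → V → ℝ) (wt : V → V → ℕ)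
    (ε : ℝ) : Prop :=
  WeakRounding G w wt ε ∧
  ∀ (u v : V) (p : G.Walk u v), IsShortestPath (fun a b => (wt a b : ℝ)) p →
    IsShortestPath w p

/-! ## The construction of `G_α`

A 3-CNF formula `α` with `m` clauses over `n` variables is given by
`C : Fin m → Fin 3 → Fin n × Bool`: the `t`-th literal of clause `j` is the variable
`(C j t).1` with polarity `(C j t).2` (`true` = positive literal, `false` = negated). -/

variable {n m : ℕ}

/-- The occurrences of variable `i` in `α`, as the lexicographically ordered list of
pairs `(j, t)` such that the `t`-th literal of clause `j` involves `x_i`. -/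
def occs (C : Fin m → Fin 3 → Fin n × Bool) (i : Fin n) : List (Fin m × Fin 3) :=
  ((List.finRange m).product (List.finRange 3)).filter (fun q => (C q.1 q.2).1 = i)

/-- The number `h` of literals of `α` involving variable `i`. -/
def hocc (C : Fin m → Fin 3 → Fin n × Bool) (i : Fin n) : ℕ := (occs C i).length

/-- The vertices of the variable gadget for `x_i`: for each occurrence `k` a triangle
`Δ_{i,k}` with left (`0`), right (`1`) and base (`2`) vertex; two pendant vertices
(`false` = `v_{i,0}`, `true` = `v_{i,h+1}`); and an inverter vertex for each negated
occurrence. -/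
def VarV (C : Fin m → Fin 3 → Fin n × Bool) (i : Fin n) : Type :=
  (Fin (hocc C i) × Fin 3) ⊕
    (Bool ⊕ {k : Fin (hocc C i) //
      (C ((occs C i).get k).1 ((occs C i).get k).2).2 = false})

/-- The vertices of the clause gadget for `C_j`: a nine-cycle, three knobs, and a centre. -/
def ClauseV : Type := (Fin 9 ⊕ Fin 3) ⊕ Unit

/-- The vertex set of `G_α`. -/
def GV (C : Fin m → Fin 3 → Fin n × Bool) : Type :=
  (Σ i : Fin n, VarV C i) ⊕ (Fin m × ClauseV)

def vtri (C : Fin m → Fin 3 → Fin n × Bool) (i : Fin n) (k : Fin (hocc C i)) (x : Fin 3) :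
    GV C := Sum.inl ⟨i, Sum.inl (k, x)⟩

def vpend (C : Fin m → Fin 3 → Fin n × Bool) (i : Fin n) (b : Bool) : GV C :=
  Sum.inl ⟨i, Sum.inr (Sum.inl b)⟩

def vinv (C : Fin m → Fin 3 → Fin n × Bool) (i : Fin n) (k : Fin (hocc C i))
    (hk : (C ((occs C i).get k).1 ((occs C i).get k).2).2 = false) : GV C :=
  Sum.inl ⟨i, Sum.inr (Sum.inr ⟨k, hk⟩)⟩

def ccyc (C : Fin m → Fin 3 → Fin n × Bool) (j : Fin m) (s : Fin 9) : GV C :=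
  Sum.inr (j, Sum.inl (Sum.inl s))

def cknob (C : Fin m → Fin 3 → Fin n × Bool) (j : Fin m) (t : Fin 3) : GV C :=
  Sum.inr (j, Sum.inl (Sum.inr t))

def cctr (C : Fin m → Fin 3 → Fin n × Bool) (j : Fin m) : GV C := Sum.inr (j, Sum.inr ())

/-- The edges of weight `2.5` inside the variable gadgets: triangle edges, chain edges,
the two pendant edges, and inverter edges. -/
def varRel (C : Fin m → Fin 3 → Fin n × Bool) (a b : GV C) : Prop :=
  (∃ (i : Fin n) (k : Fin (hocc C i)) (x y : Fin 3),
      x ≠ y ∧ a = vtri C i k x ∧ b = vtri C i k y) ∨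
  (∃ (i : Fin n) (k k' : Fin (hocc C i)),
      k'.val = k.val + 1 ∧ a = vtri C i k 1 ∧ b = vtri C i k' 0) ∨
  (∃ (i : Fin n) (k : Fin (hocc C i)), k.val = 0 ∧ a = vpend C i false ∧ b = vtri C i k 0) ∨
  (∃ (i : Fin n) (k : Fin (hocc C i)),
      k.val + 1 = hocc C i ∧ a = vpend C i true ∧ b = vtri C i k 1) ∨
  (∃ (i : Fin n) (k : Fin (hocc C i))
      (hk : (C ((occs C i).get k).1 ((occs C i).get k).2).2 = false),
      a = vinv C i k hk ∧ b = vtri C i k 2)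

/-- The handle edges, of weight `2.5`: knob `c_{j,t}` is attached to cycle vertex `3t`. -/
def handleRel (C : Fin m → Fin 3 → Fin n × Bool) (a b : GV C) : Prop :=
  ∃ (j : Fin m) (t : Fin 3), a = cknob C j t ∧ b = ccyc C j ⟨3 * t.val, by omega⟩

/-- The nonagon edges, of weight `3.6`. -/
def cycleRel (C : Fin m → Fin 3 → Fin n × Bool) (a b : GV C) : Prop :=
  ∃ (j : Fin m) (s : Fin 9), a = ccyc C j s ∧ b = ccyc C j (s + 1)

/-- The centre edges, of weight `6`. -/
def centreRel (C : Fin m → Fin 3 → Fin n × Bool) (a b : GV C) : Prop :=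
  ∃ (j : Fin m) (s : Fin 9), a = cctr C j ∧ b = ccyc C j s

/-- The clause-variable edges, of weight `D`: the knob `c_{j,t}` is joined to the base
vertex of the triangle of the corresponding occurrence of the variable `(C j t).1` if the
literal is positive, and to the inverter of that triangle if the literal is negated. -/
def cvRel (C : Fin m → Fin 3 → Fin n × Bool) (a b : GV C) : Prop :=
  ∃ (j : Fin m) (t : Fin 3) (k : Fin (hocc C (C j t).1)),
    (occs C (C j t).1).get k = (j, t) ∧ a = cknob C j t ∧
    ((∃ (hk : (C ((occs C (C j t).1).get k).1 ((occs C (C j t).1).get k).2).2 = false),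
        b = vinv C (C j t).1 k hk) ∨
      ((C j t).2 = true ∧ b = vtri C (C j t).1 k 2))

/-- The shortcut edges, of weight `2D`: between vertices of different variable gadgets, of
different clause gadgets, or of a variable gadget and a clause gadget not involving that
variable. -/
def shortRel (C : Fin m → Fin 3 → Fin n × Bool) (a b : GV C) : Prop :=
  (∃ (i i' : Fin n) (x : VarV C i) (y : VarV C i'),
      i ≠ i' ∧ a = Sum.inl ⟨i, x⟩ ∧ b = Sum.inl ⟨i', y⟩) ∨
  (∃ (j j' : Fin m) (x y : ClauseV),
      j ≠ j' ∧ a = Sum.inr (j, x) ∧ b = Sum.inr (j', y)) ∨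
  (∃ (i : Fin n) (x : VarV C i) (j : Fin m) (y : ClauseV), (∀ t, (C j t).1 ≠ i) ∧
      a = Sum.inl ⟨i, x⟩ ∧ b = Sum.inr (j, y))

/-- The graph `G_α`. -/
def Galpha (C : Fin m → Fin 3 → Fin n × Bool) : SimpleGraph (GV C) :=
  SimpleGraph.fromRel (fun a b =>
    varRel C a b ∨ handleRel C a b ∨ cycleRel C a b ∨ centreRel C a b ∨
    cvRel C a b ∨ shortRel C a b)

open Classical in
/-- The weight function of `G_α`, with `D = 5m + 20`. -/
noncomputable def ωα (C : Fin m → Fin 3 → Fin n × Bool) : GV C → GV C → ℝ := fun a b =>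
  if varRel C a b ∨ varRel C b a ∨ handleRel C a b ∨ handleRel C b a then 2.5
  else if cycleRel C a b ∨ cycleRel C b a then 3.6
  else if centreRel C a b ∨ centreRel C b a then 6
  else if cvRel C a b ∨ cvRel C b a then 5 * m + 20
  else if shortRel C a b ∨ shortRel C b a then 2 * (5 * m + 20)
  else 0

/-- The assignment `ψ` satisfies the formula: each clause has a true literal. -/
def Satisfies (C : Fin m → Fin 3 → Fin n × Bool) (ψ : Fin n → Bool) : Prop :=
  ∀ j : Fin m, ∃ t : Fin 3, (if (C j t).2 then ψ (C j t).1 else !(ψ (C j t).1)) = true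

/-- Each variable appears at most once per clause. -/
def DistinctVars (C : Fin m → Fin 3 → Fin n × Bool) : Prop :=
  ∀ (j : Fin m) (t t' : Fin 3), (C j t).1 = (C j t').1 → t = t'

/-! ## Strong roundings from shortest-path potentials -/

/-- `φ` is a distance potential towards a vertex, with `T` as its set of tight darts. -/
def IsPotential {V : Type*} (G : SimpleGraph V) (w : V → V → ℝ) (T : V → V → Prop)
    (φ : V → ℝ) : Prop :=
  ∀ x y, G.Adj x y → (T x y → φ x = w x y + φ y) ∧ (¬ T x y → φ x < w x y + φ y)

theorem IsPotential.le_wWeight {V : Type*} {G : SimpleGraph V} {w : V → V → ℝ}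
    {T : V → V → Prop} {φ : V → ℝ} (hφ : IsPotential G w T φ) {u v : V} (p : G.Walk u v) :
    φ u ≤ wWeight w p + φ v ∧
      (φ u = wWeight w p + φ v ↔ ∀ d ∈ p.darts, T d.toProd.1 d.toProd.2) := by
  induction p with
  | nil => simp [wWeight]
  | @cons u x v h p ih =>
    obtain ⟨ih₁, ih₂⟩ := ih
    obtain ⟨h₁, h₂⟩ := hφ u x h
    have hw : wWeight w (Walk.cons h p) = w u x + wWeight w p := by simp [wWeight]
    rw [hw, Walk.darts_cons, List.forall_mem_cons, ← ih₂]
    by_cases hT : T u x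
    · have := h₁ hT
      refine ⟨by linarith, fun h => ⟨hT, by linarith⟩, fun h => by linarith [h.2]⟩
    · have := h₂ hT
      refine ⟨by linarith, fun h => absurd h (by intro h; linarith), fun h => absurd h.1 hT⟩

theorem IsPotential.isShortestPath_iff {V : Type*} {G : SimpleGraph V} {w : V → V → ℝ}
    {T : V → V → Prop} {φ : V → ℝ} (hφ : IsPotential G w T φ) {u v : V}
    (q : G.Walk u v) (hq : ∀ d ∈ q.darts, T d.toProd.1 d.toProd.2) (p : G.Walk u v) :
    IsShortestPath w p ↔ p.IsPath ∧ ∀ d ∈ p.darts, T d.toProd.1 d.toProd.2 := by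
  refine and_congr_right fun _ => ?_
  rw [← (hφ.le_wWeight p).2]
  have hq' := (hφ.le_wWeight q).2.2 hq
  have hp := (hφ.le_wWeight p).1
  refine ⟨fun h => by linarith [h q], fun h r => ?_⟩
  linarith [(hφ.le_wWeight r).1]

theorem IsPotential.exists_tight_walk {V : Type*} {G : SimpleGraph V} {w : V → V → ℝ}
    {T : V → V → Prop} {φ : V → ℝ} {v : V} (hφ : IsPotential G w T φ) (h0 : ∀ x, 0 ≤ φ x)
    (hw : ∀ x y, G.Adj x y → 1 ≤ w x y)
    (hT : ∀ x, x ≠ v → G.Reachable x v → ∃ y, G.Adj x y ∧ T x y) (u : V)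
    (hu : G.Reachable u v) : ∃ q : G.Walk u v, ∀ d ∈ q.darts, T d.toProd.1 d.toProd.2 := by
  obtain ⟨N, hN⟩ := exists_nat_gt (φ u)
  induction N generalizing u with
  | zero => exact absurd (h0 u) (by simpa using hN)
  | succ N ih =>
    by_cases huv : u = v
    · subst huv
      exact ⟨Walk.nil, by simp⟩
    obtain ⟨y, hy, hTy⟩ := hT u huv hu
    have h₁ := (hφ u y hy).1 hTy
    have h₂ := hw u y hy
    obtain ⟨q, hq⟩ := ih y (hy.symm.reachable.trans hu) (by push_cast at hN; linarith)
    exact ⟨Walk.cons hy q, by simpa using ⟨hTy, hq⟩⟩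

theorem strongRounding_of_potentials {V : Type*} {G : SimpleGraph V} {w : V → V → ℝ}
    {wt : V → V → ℕ} {T : V → V → V → Prop} {φ ψ : V → V → ℝ} {ε : ℝ}
    (hφ : ∀ v, IsPotential G w (T v) (φ v))
    (hψ : ∀ v, IsPotential G (fun a b => (wt a b : ℝ)) (T v) (ψ v))
    (hself : ∀ v, φ v v = 0 ∧ ψ v v = 0) (h0 : ∀ v x, 0 ≤ φ v x)
    (hw : ∀ x y, G.Adj x y → 1 ≤ w x y)
    (hT : ∀ v x, x ≠ v → G.Reachable x v → ∃ y, G.Adj x y ∧ T v x y)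
    (herr : ∀ v x, |ψ v x - φ v x| < ε) : StrongRounding G w wt ε := by
  have key : ∀ u v (p : G.Walk u v),
      (IsShortestPath w p ↔ p.IsPath ∧ ∀ d ∈ p.darts, T v d.toProd.1 d.toProd.2) ∧
      (IsShortestPath (fun a b => (wt a b : ℝ)) p ↔
        p.IsPath ∧ ∀ d ∈ p.darts, T v d.toProd.1 d.toProd.2) := by
    intro u v p
    obtain ⟨q, hq⟩ := (hφ v).exists_tight_walk (h0 v) hw (hT v) u ⟨p⟩
    exact ⟨(hφ v).isShortestPath_iff q hq p, (hψ v).isShortestPath_iff q hq p⟩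
  refine ⟨⟨fun u v p hp => ?_, fun u v p hp => ?_⟩, fun u v p hp => ?_⟩
  · have ht := ((key u v p).1.1 hp).2
    have h₁ := ((hφ v).le_wWeight p).2.2 ht
    have h₂ := ((hψ v).le_wWeight p).2.2 ht
    rw [(hself v).1, add_zero] at h₁
    rw [(hself v).2, add_zero] at h₂
    rw [← h₁, ← h₂]
    exact herr v u
  · exact (key u v p).2.2 ((key u v p).1.1 hp)
  · exact (key u v p).1.2 ((key u v p).2.1 hp)

/-! ## Graphs made of gadgets -/

/-- `x` and `y` lie in different gadgets not joined by a link. -/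
def Far {V Γ : Type*} (g : V → Γ) (K : V → V → Prop) (x y : V) : Prop :=
  g x ≠ g y ∧ ∀ p q, K p q → ¬ (g p = g x ∧ g q = g y)

/-- No vertex of the gadget of `x` is incident to a link. -/
def Isolated {V Γ : Type*} (g : V → Γ) (K : V → V → Prop) (x : V) : Prop :=
  ∀ p q, K p q → g p ≠ g x

/-- A graph whose vertices are partitioned into gadgets by `g`. Two gadgets are joined either
by a single link edge (given by `K`), or by all possible edges. -/
structure IsGadgetGraph {V Γ : Type*} (G : SimpleGraph V) (g : V → Γ) (K : V → V → Prop) :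
    Prop where
  adj_cases : ∀ x y, G.Adj x y → g x = g y ∨ K x y ∨ Far g K x y
  adj_of_far : ∀ x y, Far g K x y → G.Adj x y
  adj_of_link : ∀ x y, K x y → G.Adj x y
  symm : ∀ x y, K x y → K y x
  ne : ∀ x y, K x y → g x ≠ g y
  unique : ∀ p q p' q', K p q → K p' q' → g p = g p' → g q = g q' → p = p' ∧ q = q'
  matching : ∀ p q q', K p q → K p q' → q = q'

/-- `δ` restricts to the distance within each gadget, for the edge weights `w`; link edges have
weight `D` and edges between far vertices have weight `2 * D`. `T v` is the set of tight darts
towards a target `v` in the same gadget. -/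
structure IsGadgetMetric {V Γ : Type*} (G : SimpleGraph V) (g : V → Γ) (K : V → V → Prop)
    (D : ℝ) (T : V → V → V → Prop) (w δ : V → V → ℝ) : Prop where
  link : ∀ x y, K x y → w x y = D
  far : ∀ x y, Far g K x y → w x y = 2 * D
  inner : ∀ x y, G.Adj x y → g x = g y → 1 ≤ w x y
  self : ∀ x, δ x x = 0
  pos : ∀ x y, g x = g y → x ≠ y → 0 < δ x y
  bound : ∀ p q x v, K p q → g x = g p → g v = g q → δ x p + δ q v < D
  le : ∀ x y, ¬ Isolated g K x → g x = g y → δ x y ≤ 2 * D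
  isolated : ∀ x y, Isolated g K x → g x = g y → x ≠ y → δ x y = 4 * D
  tight : ∀ v x y, G.Adj x y → g x = g y → g x = g v →
    (T v x y → δ x v = w x y + δ y v) ∧ (¬ T v x y → δ x v < w x y + δ y v)

open Classical in
/-- The distance in a gadget graph obtained from the distances within the gadgets. -/
noncomputable def gadgetDist {V Γ : Type*} (g : V → Γ) (K : V → V → Prop) (D : ℝ)
    (δ : V → V → ℝ) (x v : V) : ℝ :=
  if g x = g v then δ x v
  else if h : ∃ e : V × V, K e.1 e.2 ∧ g x = g e.1 ∧ g v = g e.2 then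
    δ x h.choose.1 + D + δ h.choose.2 v
  else 2 * D

/-- The tight darts of `gadgetDist`. -/
def GadgetTight {V Γ : Type*} (g : V → Γ) (K : V → V → Prop) (T : V → V → V → Prop)
    (v x y : V) : Prop :=
  (g x = g y ∧ g x = g v ∧ T v x y) ∨
  (g x = g y ∧ ∃ p q, K p q ∧ g x = g p ∧ g v = g q ∧ T p x y) ∨
  (K x y ∧ g v = g y) ∨
  (Far g K x y ∧ (y = v ∨ (g x = g v ∧ x ≠ v ∧ Isolated g K x)))

section GadgetDist

variable {V Γ : Type*} {G : SimpleGraph V} {g : V → Γ} {K : V → V → Prop} {D : ℝ}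
  {T : V → V → V → Prop} {w δ : V → V → ℝ}

theorem gadgetDist_same {x v : V} (h : g x = g v) : gadgetDist g K D δ x v = δ x v := by
  simp [gadgetDist, h]

theorem gadgetDist_far {x v : V} (h : Far g K x v) : gadgetDist g K D δ x v = 2 * D := by
  rw [gadgetDist, if_neg h.1, dif_neg]
  rintro ⟨e, he, h₁, h₂⟩
  exact h.2 _ _ he ⟨h₁.symm, h₂.symm⟩

theorem gadgetDist_link (hG : IsGadgetGraph G g K) {x v p q : V} (h : K p q) (hx : g x = g p)
    (hv : g v = g q) : gadgetDist g K D δ x v = δ x p + D + δ q v := by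
  have hne : g x ≠ g v := by rw [hx, hv]; exact hG.ne p q h
  have hex : ∃ e : V × V, K e.1 e.2 ∧ g x = g e.1 ∧ g v = g e.2 := ⟨(p, q), h, hx, hv⟩
  rw [gadgetDist, if_neg hne, dif_pos hex]
  obtain ⟨h₁, h₂, h₃⟩ := hex.choose_spec
  obtain ⟨h₄, h₅⟩ := hG.unique _ _ p q h₁ h (h₂.symm.trans hx) (h₃.symm.trans hv)
  rw [h₄, h₅]

theorem gadget_trichotomy (g : V → Γ) (K : V → V → Prop) (x v : V) :
    g x = g v ∨ (∃ p q, K p q ∧ g x = g p ∧ g v = g q) ∨ Far g K x v := by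
  by_cases h : g x = g v
  · exact Or.inl h
  by_cases h' : ∃ p q, K p q ∧ g x = g p ∧ g v = g q
  · exact Or.inr (Or.inl h')
  · refine Or.inr (Or.inr ⟨h, fun p q hpq hc => h' ⟨p, q, hpq, hc.1.symm, hc.2.symm⟩⟩)

theorem IsGadgetMetric.nonneg (hM : IsGadgetMetric G g K D T w δ) {x v : V} (h : g x = g v) :
    0 ≤ δ x v := by
  by_cases hxv : x = v
  · rw [hxv, hM.self]
  · exact (hM.pos x v h hxv).le

theorem IsGadgetMetric.gadgetDist_self (hM : IsGadgetMetric G g K D T w δ) (x : V) :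
    gadgetDist g K D δ x x = 0 := by
  rw [gadgetDist_same rfl, hM.self]

theorem IsGadgetMetric.gadgetDist_le (hG : IsGadgetGraph G g K)
    (hM : IsGadgetMetric G g K D T w δ) {x v : V} (h : g x ≠ g v) :
    gadgetDist g K D δ x v ≤ 2 * D := by
  rcases gadget_trichotomy g K x v with h' | ⟨p, q, hK, hx, hv⟩ | h'
  · exact absurd h' h
  · rw [gadgetDist_link hG hK hx hv]
    linarith [hM.bound p q x v hK hx hv]
  · rw [gadgetDist_far h']

theorem IsGadgetMetric.gadgetDist_ge (hG : IsGadgetGraph G g K)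
    (hM : IsGadgetMetric G g K D T w δ) (hD : 1 ≤ D) {x v : V} (h : g x ≠ g v) :
    D ≤ gadgetDist g K D δ x v := by
  rcases gadget_trichotomy g K x v with h' | ⟨p, q, hK, hx, hv⟩ | h'
  · exact absurd h' h
  · rw [gadgetDist_link hG hK hx hv]
    linarith [hM.nonneg hx, hM.nonneg hv.symm]
  · rw [gadgetDist_far h']
    linarith

theorem IsGadgetMetric.gadgetDist_pos (hG : IsGadgetGraph G g K)
    (hM : IsGadgetMetric G g K D T w δ) (hD : 1 ≤ D) {x v : V} (h : x ≠ v) :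
    0 < gadgetDist g K D δ x v := by
  by_cases hg : g x = g v
  · rw [gadgetDist_same hg]
    exact hM.pos x v hg h
  · linarith [hM.gadgetDist_ge hG hD hg]

theorem IsGadgetMetric.one_le (hG : IsGadgetGraph G g K)
    (hM : IsGadgetMetric G g K D T w δ) (hD : 1 ≤ D) (x y : V) (h : G.Adj x y) :
    1 ≤ w x y := by
  rcases hG.adj_cases x y h with h' | h' | h'
  · exact hM.inner x y h h'
  · rw [hM.link x y h']
    exact hD
  · rw [hM.far x y h']
    linarith

theorem Far.not_link {x y : V} (h : Far g K x y) : ¬ K x y := fun h' => h.2 x y h' ⟨rfl, rfl⟩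

/-- Leaving the gadget of `x` along the link `x`-`y` costs more than `gadgetDist`
when the target is not in the gadget of `y`. -/
theorem IsGadgetMetric.link_strict (hG : IsGadgetGraph G g K)
    (hM : IsGadgetMetric G g K D T w δ) (hD : 1 ≤ D) {x y v : V} (h : K x y)
    (hv : g v ≠ g y) : gadgetDist g K D δ x v < D + gadgetDist g K D δ y v := by
  by_cases hxv : g x = g v
  · rw [gadgetDist_same hxv, gadgetDist_link hG (hG.symm x y h) rfl hxv.symm]
    linarith [hM.self y]
  have hx := hM.gadgetDist_le hG hxv
  rcases gadget_trichotomy g K y v with h' | ⟨p, q, hK, hy, hq⟩ | h'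
  · exact absurd h'.symm hv
  · rw [gadgetDist_link hG hK hy hq]
    have hyp : y ≠ p := by
      rintro rfl
      have : q = x := hG.matching y q x hK (hG.symm x y h)
      exact hxv (by rw [hq, this])
    linarith [hM.pos y p hy hyp, hM.nonneg hq.symm]
  · rw [gadgetDist_far h']
    linarith

theorem IsGadgetMetric.isPotential (hG : IsGadgetGraph G g K)
    (hM : IsGadgetMetric G g K D T w δ) (hD : 1 ≤ D) (v : V) :
    IsPotential G w (GadgetTight g K T v) (fun x => gadgetDist g K D δ x v) := by
  intro x y hxy
  dsimp only
  rcases hG.adj_cases x y hxy with h | h | h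
  · have hK : ¬ K x y := fun h' => hG.ne x y h' h
    have hF : ¬ Far g K x y := fun h' => h'.1 h
    rcases gadget_trichotomy g K x v with h' | ⟨p, q, hpq, hx, hv⟩ | h'
    · have hT : GadgetTight g K T v x y ↔ T v x y := by
        constructor
        · rintro (⟨-, -, h₁⟩ | ⟨-, p, q, hpq, h₁, h₂, -⟩ | h₁ | h₁)
          · exact h₁
          · exact absurd (h₁.symm.trans (h'.trans h₂)) (hG.ne p q hpq)
          · exact absurd h₁.1 hK
          · exact absurd h₁.1 hF
        · exact fun h₁ => Or.inl ⟨h, h', h₁⟩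
      rw [hT, gadgetDist_same h', gadgetDist_same (h.symm.trans h')]
      exact hM.tight v x y hxy h h'
    · have hT : GadgetTight g K T v x y ↔ T p x y := by
        constructor
        · rintro (⟨-, h₁, -⟩ | ⟨-, p', q', hpq', h₁, h₂, h₃⟩ | h₁ | h₁)
          · exact absurd (hx.symm.trans (h₁.trans hv)) (hG.ne p q hpq)
          · rwa [(hG.unique p q p' q' hpq hpq' (hx.symm.trans h₁) (hv.symm.trans h₂)).1]
          · exact absurd h₁.1 hK
          · exact absurd h₁.1 hF
        · exact fun h₁ => Or.inr (Or.inl ⟨h, p, q, hpq, hx, hv, h₁⟩)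
      rw [hT, gadgetDist_link hG hpq hx hv, gadgetDist_link hG hpq (h.symm.trans hx) hv]
      obtain ⟨h₁, h₂⟩ := hM.tight p x y hxy h hx
      exact ⟨fun h₃ => by linarith [h₁ h₃], fun h₃ => by linarith [h₂ h₃]⟩
    · have hT : ¬ GadgetTight g K T v x y := by
        rintro (⟨-, h₁, -⟩ | ⟨-, p, q, hpq, h₁, h₂, -⟩ | h₁ | h₁)
        · exact h'.1 h₁
        · exact h'.2 p q hpq ⟨h₁.symm, h₂.symm⟩
        · exact hK h₁.1
        · exact hF h₁.1
      have hyv : Far g K y v := by simpa only [Far, h] using h'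
      rw [gadgetDist_far h', gadgetDist_far hyv]
      exact ⟨fun h₁ => absurd h₁ hT, fun _ => by linarith [hM.inner x y hxy h]⟩
  · rw [hM.link x y h]
    have hne := hG.ne x y h
    have hT : GadgetTight g K T v x y ↔ g v = g y := by
      constructor
      · rintro (h₁ | h₁ | h₁ | h₁)
        · exact absurd h₁.1 hne
        · exact absurd h₁.1 hne
        · exact h₁.2
        · exact absurd h h₁.1.not_link
      · exact fun h₁ => Or.inr (Or.inr (Or.inl ⟨h, h₁⟩))
    rw [hT]
    refine ⟨fun hv => ?_, fun hv => hM.link_strict hG hD h hv⟩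
    rw [gadgetDist_link hG h rfl hv, gadgetDist_same hv.symm, hM.self]
    ring
  · rw [hM.far x y h]
    have hT : GadgetTight g K T v x y ↔
        (y = v ∨ (g x = g v ∧ x ≠ v ∧ Isolated g K x)) := by
      constructor
      · rintro (h₁ | h₁ | h₁ | h₁)
        · exact absurd h₁.1 h.1
        · exact absurd h₁.1 h.1
        · exact absurd h₁.1 h.not_link
        · exact h₁.2
      · exact fun h₁ => Or.inr (Or.inr (Or.inr ⟨h, h₁⟩))
    rw [hT]
    constructor
    · rintro (rfl | ⟨h₁, h₂, h₃⟩)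
      · rw [gadgetDist_far h, hM.gadgetDist_self, add_zero]
      · have hyv : Far g K y v := by
          refine ⟨fun h₄ => h.1 (h₁.trans h₄.symm), fun p q hpq h₄ => ?_⟩
          exact h₃ q p (hG.symm p q hpq) (h₄.2.trans h₁.symm)
        rw [gadgetDist_same h₁, gadgetDist_far hyv, hM.isolated x v h₃ h₁ h₂]
        ring
    · intro h₁
      rw [not_or] at h₁
      have hy := hM.gadgetDist_pos hG hD h₁.1
      by_cases hxv : g x = g v
      · by_cases hx : x = v
        · subst hx
          rw [hM.gadgetDist_self]
          linarith
        · have hI : ¬ Isolated g K x := fun h₂ => h₁.2 ⟨hxv, hx, h₂⟩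
          rw [gadgetDist_same hxv]
          linarith [hM.le x v hI hxv]
      · linarith [hM.gadgetDist_le hG hxv]

theorem IsGadgetGraph.exists_tight (hG : IsGadgetGraph G g K)
    (hI : ∀ x y, Isolated g K x → g x = g y → ¬ G.Adj x y)
    (hT : ∀ v x, g x = g v → x ≠ v → ¬ Isolated g K x →
      ∃ y, G.Adj x y ∧ g x = g y ∧ T v x y)
    (v x : V) (hxv : x ≠ v) (hr : G.Reachable x v) :
    ∃ y, G.Adj x y ∧ GadgetTight g K T v x y := by
  rcases gadget_trichotomy g K x v with h | ⟨p, q, hpq, hx, hv⟩ | h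
  · by_cases hx : Isolated g K x
    · obtain ⟨r⟩ := hr
      cases r with
      | nil => exact absurd rfl hxv
      | @cons _ y _ hy _ =>
        refine ⟨y, hy, Or.inr (Or.inr (Or.inr ⟨?_, Or.inr ⟨h, hxv, hx⟩⟩))⟩
        rcases hG.adj_cases x y hy with h' | h' | h'
        · exact absurd hy (hI x y hx h')
        · exact absurd rfl (hx x y h')
        · exact h'
    · obtain ⟨y, h₁, h₂, h₃⟩ := hT v x h hxv hx
      exact ⟨y, h₁, Or.inl ⟨h₂, h, h₃⟩⟩
  · by_cases hxp : x = p
    · subst hxp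
      exact ⟨q, hG.adj_of_link x q hpq, Or.inr (Or.inr (Or.inl ⟨hpq, hv⟩))⟩
    · obtain ⟨y, h₁, h₂, h₃⟩ := hT p x hx hxp (fun h => h p q hpq hx.symm)
      exact ⟨y, h₁, Or.inr (Or.inl ⟨h₂, p, q, hpq, hx, hv, h₃⟩)⟩
  · exact ⟨v, hG.adj_of_far x v h, Or.inr (Or.inr (Or.inr ⟨h, Or.inl rfl⟩))⟩

/-- A gadget graph has a strong `1`-rounding as soon as the distances within gadgets can be
rounded compatibly. -/
theorem IsGadgetGraph.strongRounding (hG : IsGadgetGraph G g K) (hD : 1 ≤ D)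
    {wt : V → V → ℕ} {δ' : V → V → ℝ} (hM : IsGadgetMetric G g K D T w δ)
    (hM' : IsGadgetMetric G g K D T (fun a b => (wt a b : ℝ)) δ')
    (hI : ∀ x y, Isolated g K x → g x = g y → ¬ G.Adj x y)
    (hT : ∀ v x, g x = g v → x ≠ v → ¬ Isolated g K x →
      ∃ y, G.Adj x y ∧ g x = g y ∧ T v x y)
    (herr : ∀ x v, g x = g v → |δ' x v - δ x v| < 1)
    (herr' : ∀ p q x v, K p q → g x = g p → g v = g q →
      |(δ' x p - δ x p) + (δ' q v - δ q v)| < 1) : StrongRounding G w wt 1 := by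
  refine strongRounding_of_potentials (hM.isPotential hG hD) (hM'.isPotential hG hD)
    (fun v => ⟨hM.gadgetDist_self v, hM'.gadgetDist_self v⟩) (fun v x => ?_) (hM.one_le hG hD)
    (hG.exists_tight hI hT) (fun v x => ?_)
  · by_cases h : x = v
    · rw [h, hM.gadgetDist_self]
    · exact (hM.gadgetDist_pos hG hD h).le
  · rcases gadget_trichotomy g K x v with h | ⟨p, q, hpq, hx, hv⟩ | h
    · rw [gadgetDist_same h, gadgetDist_same h]
      exact herr x v h
    · rw [gadgetDist_link hG hpq hx hv, gadgetDist_link hG hpq hx hv]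
      convert herr' p q x v hpq hx hv using 2
      ring
    · rw [gadgetDist_far h, gadgetDist_far h]
      simp

end GadgetDist

/-! ## Clause gadgets -/

instance : DecidableEq ClauseV := inferInstanceAs (DecidableEq ((Fin 9 ⊕ Fin 3) ⊕ Unit))

instance : Fintype ClauseV := inferInstanceAs (Fintype ((Fin 9 ⊕ Fin 3) ⊕ Unit))

/-- The cycle vertex to which the `t`-th knob is attached. -/
def anchor (t : Fin 3) : Fin 9 := ⟨3 * t.val, by omega⟩

/-- The edge weights in a clause gadget (`0` for non-edges), where the `t`-th handle has weight
`h t`, the edge from `s` to `s + 1` of the cycle has weight `c s`, and the centre edges have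
weight `z`. -/
def clauseWeight (h : Fin 3 → ℕ) (c : Fin 9 → ℕ) (z : ℕ) : ClauseV → ClauseV → ℕ
  | Sum.inl (Sum.inl s), Sum.inl (Sum.inl s') =>
    if s' = s + 1 then c s else if s = s' + 1 then c s' else 0
  | Sum.inl (Sum.inl s), Sum.inl (Sum.inr t) => if s = anchor t then h t else 0
  | Sum.inl (Sum.inr t), Sum.inl (Sum.inl s) => if s = anchor t then h t else 0
  | Sum.inl (Sum.inl _), Sum.inr _ => z
  | Sum.inr _, Sum.inl (Sum.inl _) => z
  | _, _ => 0

/-- The distances between the cycle vertices of a clause gadget. -/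
def cycleDist (c : Fin 9 → ℕ) (z : ℕ) (s s' : Fin 9) : ℕ :=
  match (s' - s).val with
  | 0 => 0
  | 1 => c s
  | 2 => c s + c (s + 1)
  | 3 => c s + c (s + 1) + c (s + 2)
  | 6 => c s' + c (s' + 1) + c (s' + 2)
  | 7 => c s' + c (s' + 1)
  | 8 => c s'
  | _ => 2 * z

/-- The distances in a clause gadget. -/
def clauseDist (h : Fin 3 → ℕ) (c : Fin 9 → ℕ) (z : ℕ) : ClauseV → ClauseV → ℕ
  | Sum.inl (Sum.inl s), Sum.inl (Sum.inl s') => cycleDist c z s s'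
  | Sum.inl (Sum.inl s), Sum.inl (Sum.inr t) => cycleDist c z s (anchor t) + h t
  | Sum.inl (Sum.inr t), Sum.inl (Sum.inl s) => h t + cycleDist c z (anchor t) s
  | Sum.inl (Sum.inr t), Sum.inl (Sum.inr t') =>
    if t = t' then 0 else h t + cycleDist c z (anchor t) (anchor t') + h t'
  | Sum.inl (Sum.inl _), Sum.inr _ => z
  | Sum.inr _, Sum.inl (Sum.inl _) => z
  | Sum.inl (Sum.inr t), Sum.inr _ => h t + z
  | Sum.inr _, Sum.inl (Sum.inr t) => z + h t
  | Sum.inr _, Sum.inr _ => 0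

/-- The original weights of a clause gadget, in tenths. -/
def clauseWeight₀ : ClauseV → ClauseV → ℕ := clauseWeight (fun _ => 25) (fun _ => 36) 60

/-- The original distances in a clause gadget, in tenths. -/
def clauseDist₀ : ClauseV → ClauseV → ℕ := clauseDist (fun _ => 25) (fun _ => 36) 60

/-- The rounded weight of a handle, depending on whether its literal is true. -/
def handleRound (b : Bool) : ℕ := if b then 2 else 3

/-- The rounded weights of the nine-cycle: the three edges between consecutive anchors get
weights `3`, `4`, `3` if both of their literals are false, and `4`, `3`, `4` otherwise. -/
def cycleRound (b : Fin 3 → Bool) (s : Fin 9) : ℕ :=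
  let t : Fin 3 := ⟨s.val / 3, by omega⟩
  if (s.val % 3 = 1) = (b t = false ∧ b (t + 1) = false) then 4 else 3

/-- The rounded weights of a clause gadget whose `t`-th literal has truth value `b t`. -/
def clauseWeight₁ (b : Fin 3 → Bool) : ClauseV → ClauseV → ℕ :=
  clauseWeight (fun t => handleRound (b t)) (cycleRound b) 6

/-- The rounded distances in a clause gadget whose `t`-th literal has truth value `b t`. -/
def clauseDist₁ (b : Fin 3 → Bool) : ClauseV → ClauseV → ℕ :=
  clauseDist (fun t => handleRound (b t)) (cycleRound b) 6

set_option maxRecDepth 100000 in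
theorem clauseDist_edge (b : Fin 3 → Bool) (hb : ∃ t, b t = true) (v x y : ClauseV)
    (h : 0 < clauseWeight₀ x y) :
    (clauseDist₀ x v = clauseWeight₀ x y + clauseDist₀ y v ∧
      clauseDist₁ b x v = clauseWeight₁ b x y + clauseDist₁ b y v) ∨
    (clauseDist₀ x v < clauseWeight₀ x y + clauseDist₀ y v ∧
      clauseDist₁ b x v < clauseWeight₁ b x y + clauseDist₁ b y v) := by
  revert b v x y
  decide +kernel

theorem clauseDist_exists_tight (x v : ClauseV) (h : x ≠ v) :
    ∃ y, 0 < clauseWeight₀ x y ∧ clauseDist₀ x v = clauseWeight₀ x y + clauseDist₀ y v := by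
  revert x v
  decide +kernel

theorem clauseWeight_pos (b : Fin 3 → Bool) (x y : ClauseV) (h : 0 < clauseWeight₀ x y) :
    10 ≤ clauseWeight₀ x y ∧ 1 ≤ clauseWeight₁ b x y := by
  revert b x y
  decide +kernel

theorem clauseWeight_comm (b : Fin 3 → Bool) (x y : ClauseV) :
    clauseWeight₁ b x y = clauseWeight₁ b y x := by
  revert b x y
  decide +kernel

theorem clauseWeight_cycle (s : Fin 9) :
    clauseWeight₀ (Sum.inl (Sum.inl s)) (Sum.inl (Sum.inl (s + 1))) = 36 ∧
    clauseWeight₀ (Sum.inl (Sum.inl (s + 1))) (Sum.inl (Sum.inl s)) = 36 := by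
  revert s
  decide +kernel

theorem clauseDist_self (b : Fin 3 → Bool) (x : ClauseV) :
    clauseDist₀ x x = 0 ∧ clauseDist₁ b x x = 0 := by
  revert b x
  decide +kernel

theorem clauseDist_pos (b : Fin 3 → Bool) (x y : ClauseV) (h : x ≠ y) :
    0 < clauseDist₀ x y ∧ 0 < clauseDist₁ b x y := by
  revert b x y
  decide +kernel

theorem clauseDist_comm (b : Fin 3 → Bool) (x y : ClauseV) :
    clauseDist₀ x y = clauseDist₀ y x ∧ clauseDist₁ b x y = clauseDist₁ b y x := by
  revert b x y
  decide +kernel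

theorem clauseDist_le (b : Fin 3 → Bool) (hb : ∃ t, b t = true) (x y : ClauseV) :
    clauseDist₀ x y ≤ 160 ∧ clauseDist₁ b x y ≤ 16 := by
  revert b x y
  decide +kernel

theorem clauseDist_error (b : Fin 3 → Bool) (hb : ∃ t, b t = true) (x y : ClauseV) :
    10 * clauseDist₁ b x y < clauseDist₀ x y + 10 ∧
    clauseDist₀ x y < 10 * clauseDist₁ b x y + 10 := by
  revert b x y
  decide +kernel

/-- The rounding error from a knob, not counting the rounding error of its handle, is small. -/
theorem clauseDist_error_knob (b : Fin 3 → Bool) (hb : ∃ t, b t = true) (t : Fin 3)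
    (y : ClauseV) :
    10 * clauseDist₁ b (Sum.inl (Sum.inr t)) y + 25 <
      clauseDist₀ (Sum.inl (Sum.inr t)) y + 10 * handleRound (b t) + 10 ∧
    clauseDist₀ (Sum.inl (Sum.inr t)) y + 10 * handleRound (b t) <
      10 * clauseDist₁ b (Sum.inl (Sum.inr t)) y + 25 + 10 := by
  revert b t y
  decide +kernel

/-! ## Variable gadgets

A vertex of a variable gadget is encoded by the index `k` of its triangle and its type:
left (`0`), right (`1`), base (`2`) or inverter (`3`). The triangles have indices `1, …, h`, the
first pendant vertex counts as the right vertex of a triangle `0`, and the last one as the left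
vertex of a triangle `h + 1`. The edges outside the triangles get weight `a`, and those of the
triangles get weight `5 - a`. -/

/-- The distance from a vertex to the right vertex of its triangle. -/
noncomputable def distRight (a : ℝ) : Fin 4 → ℝ := ![5 - a, 0, 5 - a, 5]

/-- The distance from a vertex to the left vertex of its triangle. -/
noncomputable def distLeft (a : ℝ) : Fin 4 → ℝ := ![0, 5 - a, 5 - a, 5]

/-- The distance between two vertices of the same triangle (and its inverter). -/
noncomputable def triDist (a : ℝ) : Fin 4 → Fin 4 → ℝ :=
  ![![0, 5 - a, 5 - a, 5], ![5 - a, 0, 5 - a, 5], ![5 - a, 5 - a, 0, a], ![5, 5, a, 0]]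

/-- The distances in a chain of triangles. -/
noncomputable def chainDist (a : ℝ) (c d : ℕ × Fin 4) : ℝ :=
  if c.1 = d.1 then triDist a c.2 d.2
  else if c.1 < d.1 then distRight a c.2 + 5 * ((d.1 : ℝ) - c.1 - 1) + a + distLeft a d.2
  else distRight a d.2 + 5 * ((c.1 : ℝ) - d.1 - 1) + a + distLeft a c.2

/-- The edges of a chain of triangles, each with one orientation. -/
def ChainRel (c d : ℕ × Fin 4) : Prop :=
  (c.1 = d.1 ∧ c.2 ≠ d.2 ∧ c.2 ≠ 3 ∧ d.2 ≠ 3) ∨ (d.1 = c.1 + 1 ∧ c.2 = 1 ∧ d.2 = 0) ∨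
    (c.1 = d.1 ∧ c.2 = 3 ∧ d.2 = 2)

/-- The rounded weights in a chain of triangles. -/
def chainWeight (a : ℕ) (c d : ℕ × Fin 4) : ℕ :=
  if c.1 = d.1 ∧ c.2 ≠ 3 ∧ d.2 ≠ 3 then 5 - a else a

/-- The codes of the vertices of a chain of `h` triangles. -/
def ChainValid (h : ℕ) (c : ℕ × Fin 4) : Prop :=
  c.1 ≤ h + 1 ∧ (c.1 = 0 → c.2 = 1) ∧ (c.1 = h + 1 → c.2 = 0)

theorem chainWeight_comm (a : ℕ) (c d : ℕ × Fin 4) : chainWeight a c d = chainWeight a d c := by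
  simp only [chainWeight, eq_comm (a := c.1), and_comm (a := c.2 ≠ 3)]

theorem chainDist_comm (a : ℝ) (c d : ℕ × Fin 4) : chainDist a c d = chainDist a d c := by
  obtain ⟨k, s⟩ := c
  obtain ⟨l, r⟩ := d
  rcases lt_trichotomy k l with h | rfl | h
  · simp [chainDist, h, h.ne, h.ne', h.not_gt]
  · simp only [chainDist, if_true]
    fin_cases s <;> fin_cases r <;> rfl
  · simp [chainDist, h, h.ne, h.ne', h.not_gt]

theorem chainDist_self (a : ℝ) (c : ℕ × Fin 4) : chainDist a c c = 0 := by
  obtain ⟨k, s⟩ := c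
  simp only [chainDist, if_true]
  fin_cases s <;> rfl

theorem chainDist_of_lt (a : ℝ) {k l : ℕ} (s r : Fin 4) (h : k < l) :
    chainDist a (k, s) (l, r) =
      distRight a s + 5 * ((l : ℝ) - k - 1) + a + distLeft a r := by
  simp [chainDist, h, h.ne]

theorem chainDist_of_gt (a : ℝ) {k l : ℕ} (s r : Fin 4) (h : l < k) :
    chainDist a (k, s) (l, r) =
      distRight a r + 5 * ((k : ℝ) - l - 1) + a + distLeft a s := by
  rw [chainDist_comm, chainDist_of_lt a r s h]

theorem chainDist_of_eq (a : ℝ) (k : ℕ) (s r : Fin 4) :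
    chainDist a (k, s) (k, r) = triDist a s r := by
  simp [chainDist]

theorem chainDist_edge {a : ℕ} (ha₂ : 2 ≤ a) (ha₃ : a ≤ 3) (v c d : ℕ × Fin 4)
    (hcd : ChainRel c d ∨ ChainRel d c) :
    (chainDist (5 / 2) c v = 5 / 2 + chainDist (5 / 2) d v ∧
      chainDist a c v = chainWeight a c d + chainDist a d v) ∨
    (chainDist (5 / 2) c v < 5 / 2 + chainDist (5 / 2) d v ∧
      chainDist a c v < chainWeight a c d + chainDist a d v) := by
  obtain ⟨k, s⟩ := c
  obtain ⟨k', s'⟩ := d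
  obtain ⟨l, r⟩ := v
  have h₂ : (2 : ℝ) ≤ a := by exact_mod_cast ha₂
  have h₃ : (a : ℝ) ≤ 3 := by exact_mod_cast ha₃
  have h₅ : ((5 - a : ℕ) : ℝ) = 5 - a := by push_cast [show a ≤ 5 by omega]; ring
  by_cases hk : k = k'
  · subst hk
    have hcd' : (s ≠ s' ∧ s ≠ 3 ∧ s' ≠ 3) ∨ (s = 3 ∧ s' = 2) ∨ (s = 2 ∧ s' = 3) := by
      rcases hcd with (h | h | h) | (h | h | h) <;> simp at h <;> tauto
    clear hcd
    rcases lt_trichotomy k l with h | rfl | h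
    · simp only [chainDist_of_lt _ _ _ h, chainWeight]
      fin_cases s <;> fin_cases s' <;>
        first
        | exact absurd hcd' (by decide)
        | (left; constructor <;> simp [distRight, h₅] <;> linarith)
        | (right; constructor <;> simp [distRight, h₅] <;> linarith)
    · simp only [chainDist_of_eq, chainWeight]
      fin_cases s <;> fin_cases s' <;> fin_cases r <;>
        first
        | exact absurd hcd' (by decide)
        | (left; constructor <;> simp [triDist, h₅] <;> linarith)
        | (right; constructor <;> simp [triDist, h₅] <;> linarith)
    · simp only [chainDist_of_gt _ _ _ h, chainWeight]
      fin_cases s <;> fin_cases s' <;>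
        first
        | exact absurd hcd' (by decide)
        | (left; constructor <;> simp [distLeft, h₅] <;> linarith)
        | (right; constructor <;> simp [distLeft, h₅] <;> linarith)
  · have hw : chainWeight a (k, s) (k', s') = a := by simp [chainWeight, hk]
    rw [hw]
    have hcd' : (k' = k + 1 ∧ s = 1 ∧ s' = 0) ∨ (k = k' + 1 ∧ s = 0 ∧ s' = 1) := by
      rcases hcd with (h | h | h) | (h | h | h) <;> simp at h <;> tauto
    rcases hcd' with ⟨rfl, rfl, rfl⟩ | ⟨rfl, rfl, rfl⟩
    · have hl : l < k ∨ l = k ∨ l = k + 1 ∨ k + 1 < l := by omega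
      rcases hl with h | rfl | rfl | h
      · simp only [chainDist_of_gt _ _ _ h, chainDist_of_gt _ _ _ (show l < k + 1 by omega)]
        right; constructor <;> simp [distLeft] <;> linarith
      · simp only [chainDist_of_gt _ _ _ (show l < l + 1 by omega), chainDist_of_eq]
        right; constructor <;> fin_cases r <;> simp [distLeft, distRight, triDist] <;> linarith
      · simp only [chainDist_of_lt _ _ _ (show k < k + 1 by omega), chainDist_of_eq]
        left; constructor <;> fin_cases r <;> simp [distLeft, distRight, triDist]
      · simp only [chainDist_of_lt _ _ _ h, chainDist_of_lt _ _ _ (show k < l by omega)]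
        left; constructor <;> simp [distRight] <;> linarith
    · have hl : l < k' ∨ l = k' ∨ l = k' + 1 ∨ k' + 1 < l := by omega
      rcases hl with h | rfl | rfl | h
      · simp only [chainDist_of_gt _ _ _ h, chainDist_of_gt _ _ _ (show l < k' + 1 by omega)]
        left; constructor <;> simp [distLeft] <;> linarith
      · simp only [chainDist_of_gt _ _ _ (show l < l + 1 by omega), chainDist_of_eq]
        left; constructor <;> fin_cases r <;> simp [distLeft, distRight, triDist] <;> linarith
      · simp only [chainDist_of_lt _ _ _ (show k' < k' + 1 by omega), chainDist_of_eq]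
        right; constructor <;> fin_cases r <;> simp [distLeft, distRight, triDist] <;> linarith
      · simp only [chainDist_of_lt _ _ _ h, chainDist_of_lt _ _ _ (show k' < l by omega)]
        right; constructor <;> simp [distRight] <;> linarith

theorem chainDist_pos {a : ℝ} (ha₂ : 2 ≤ a) (ha₃ : a ≤ 3) {c d : ℕ × Fin 4} (hcd : c ≠ d) :
    0 < chainDist a c d := by
  have hlt : ∀ (k l : ℕ) (s r : Fin 4), k < l → 0 < chainDist a (k, s) (l, r) := by
    intro k l s r h
    have hkl : (k : ℝ) + 1 ≤ l := by exact_mod_cast h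
    have hs : 0 ≤ distRight a s := by fin_cases s <;> simp [distRight] <;> linarith
    have hr : 0 ≤ distLeft a r := by fin_cases r <;> simp [distLeft] <;> linarith
    rw [chainDist_of_lt a s r h]
    linarith
  obtain ⟨k, s⟩ := c
  obtain ⟨l, r⟩ := d
  rcases lt_trichotomy k l with h | rfl | h
  · exact hlt k l s r h
  · rw [chainDist_of_eq]
    have hsr : s ≠ r := fun h => hcd (by rw [h])
    fin_cases s <;> fin_cases r <;> simp [triDist] at hsr ⊢ <;> linarith
  · rw [chainDist_comm]
    exact hlt l k r s h

theorem chainDist_le {a : ℝ} (ha₂ : 2 ≤ a) (ha₃ : a ≤ 3) {h : ℕ} (h0 : h ≠ 0)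
    {c d : ℕ × Fin 4} (hc : ChainValid h c) (hd : ChainValid h d) :
    chainDist a c d ≤ 5 * h + 3 := by
  have hR : ∀ k s, ChainValid h (k, s) → distRight a s ≤ 5 * k := by
    intro k s hks
    rcases Nat.eq_zero_or_pos k with rfl | hk
    · have hs : s = 1 := hks.2.1 rfl
      simp [hs, distRight]
    · have : (1 : ℝ) ≤ k := by exact_mod_cast hk
      fin_cases s <;> simp [distRight] <;> linarith
  have hL : ∀ k s, ChainValid h (k, s) → distLeft a s ≤ 5 * ((h : ℝ) + 1 - k) := by
    intro k s hks
    by_cases hk : k = h + 1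
    · have hs : s = 0 := hks.2.2 hk
      simp [hs, distLeft, hk]
    · have hk' : k ≤ h := by have : k ≤ h + 1 := hks.1; omega
      have : (k : ℝ) ≤ h := by exact_mod_cast hk'
      fin_cases s <;> simp [distLeft] <;> linarith
  obtain ⟨k, s⟩ := c
  obtain ⟨l, r⟩ := d
  rcases lt_trichotomy k l with hkl | rfl | hkl
  · rw [chainDist_of_lt a s r hkl]
    linarith [hR k s hc, hL l r hd]
  · have : (1 : ℝ) ≤ h := by exact_mod_cast Nat.pos_of_ne_zero h0
    rw [chainDist_of_eq]
    fin_cases s <;> fin_cases r <;> simp [triDist] <;> linarith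
  · rw [chainDist_of_gt a s r hkl]
    linarith [hR l r hd, hL k s hc]

theorem chainDist_error {a : ℝ} (ha₂ : 2 ≤ a) (ha₃ : a ≤ 3) (c d : ℕ × Fin 4) :
    |chainDist a c d - chainDist (5 / 2) c d| < 1 := by
  obtain ⟨k, s⟩ := c
  obtain ⟨l, r⟩ := d
  rw [abs_lt]
  rcases lt_trichotomy k l with h | rfl | h
  · rw [chainDist_of_lt _ s r h, chainDist_of_lt _ s r h]
    fin_cases s <;> fin_cases r <;> simp [distLeft, distRight] <;> constructor <;> linarith
  · rw [chainDist_of_eq, chainDist_of_eq]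
    fin_cases s <;> fin_cases r <;> simp [triDist] <;> constructor <;> linarith
  · rw [chainDist_of_gt _ s r h, chainDist_of_gt _ s r h]
    fin_cases s <;> fin_cases r <;> simp [distLeft, distRight] <;> constructor <;> linarith

theorem chainDist_error_base (a : ℝ) (c : ℕ × Fin 4) (l : ℕ) (hc : c.1 = l → c.2 ≠ 3) :
    chainDist a c (l, 2) - chainDist (5 / 2) c (l, 2) = 0 ∨
    chainDist a c (l, 2) - chainDist (5 / 2) c (l, 2) = 5 / 2 - a := by
  obtain ⟨k, s⟩ := c
  rcases lt_trichotomy k l with h | rfl | h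
  · rw [chainDist_of_lt _ s 2 h, chainDist_of_lt _ s 2 h]
    fin_cases s <;> simp [distLeft, distRight]
  · rw [chainDist_of_eq, chainDist_of_eq]
    fin_cases s <;> simp [triDist] at hc ⊢
  · rw [chainDist_of_gt _ s 2 h, chainDist_of_gt _ s 2 h]
    fin_cases s <;> simp [distLeft, distRight] <;> left <;> linarith

theorem chainDist_error_inverter (a : ℝ) (c : ℕ × Fin 4) (l : ℕ) :
    chainDist a c (l, 3) - chainDist (5 / 2) c (l, 3) = 0 ∨
    chainDist a c (l, 3) - chainDist (5 / 2) c (l, 3) = a - 5 / 2 := by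
  obtain ⟨k, s⟩ := c
  rcases lt_trichotomy k l with h | rfl | h
  · rw [chainDist_of_lt _ s 3 h, chainDist_of_lt _ s 3 h]
    fin_cases s <;> simp [distLeft, distRight] <;> left <;> linarith
  · rw [chainDist_of_eq, chainDist_of_eq]
    fin_cases s <;> simp [triDist]
  · rw [chainDist_of_gt _ s 3 h, chainDist_of_gt _ s 3 h]
    fin_cases s <;> simp [distLeft, distRight]

theorem chainDist_exists_tight {h : ℕ} {c d : ℕ × Fin 4} (hc : ChainValid h c)
    (hd : ChainValid h d) (hcd : c ≠ d) :
    ∃ c', ChainValid h c' ∧ (c'.2 = 3 → c' = d) ∧ (ChainRel c c' ∨ ChainRel c' c) ∧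
      chainDist (5 / 2) c d = 5 / 2 + chainDist (5 / 2) c' d := by
  obtain ⟨k, s⟩ := c
  obtain ⟨l, r⟩ := d
  obtain ⟨hk, hk₀, hk₁⟩ : k ≤ h + 1 ∧ (k = 0 → s = 1) ∧ (k = h + 1 → s = 0) := hc
  obtain ⟨hl, hl₀, hl₁⟩ : l ≤ h + 1 ∧ (l = 0 → r = 1) ∧ (l = h + 1 → r = 0) := hd
  rcases lt_trichotomy k l with hkl | rfl | hkl
  · by_cases hs : s = 1
    · subst hs
      refine ⟨(k + 1, 0), ⟨by simp; omega, by simp, by simp⟩, by simp,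
        Or.inl (Or.inr (Or.inl ⟨rfl, rfl, rfl⟩)), ?_⟩
      rw [chainDist_of_lt _ _ _ hkl]
      obtain rfl | hkl' : l = k + 1 ∨ k + 1 < l := by omega
      · rw [chainDist_of_eq]
        fin_cases r <;> simp [distLeft, distRight, triDist]
      · rw [chainDist_of_lt _ _ _ hkl']
        simp [distRight]
        ring
    · have hk' : k ≠ 0 := fun e => hs (hk₀ e)
      obtain ⟨s', hs', hrel, hdist⟩ : ∃ s', s' ≠ 3 ∧
          (ChainRel (k, s) (k, s') ∨ ChainRel (k, s') (k, s)) ∧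
          distRight (5 / 2) s = 5 / 2 + distRight (5 / 2) s' := by
        fin_cases s
        · exact ⟨1, by decide, by simp [ChainRel], by simp [distRight]; norm_num⟩
        · exact absurd rfl hs
        · exact ⟨1, by decide, by simp [ChainRel], by simp [distRight]; norm_num⟩
        · exact ⟨2, by decide, by simp [ChainRel], by simp [distRight]⟩
      refine ⟨(k, s'), ⟨hk, fun e => absurd e hk', fun e => ?_⟩, fun e => absurd e hs', hrel, ?_⟩
      · simp at e
        omega
      · rw [chainDist_of_lt _ _ _ hkl, chainDist_of_lt _ _ _ hkl, hdist]
        ring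
  · have hsr : s ≠ r := fun e => hcd (by rw [e])
    have hk' : (s ≠ 1 ∧ s ≠ 0) ∨ (r ≠ 1 ∧ r ≠ 0) → k ≠ 0 ∧ k ≠ h + 1 := by
      rintro (⟨h₁, h₀⟩ | ⟨h₁, h₀⟩)
      · exact ⟨fun e => h₁ (hk₀ e), fun e => h₀ (hk₁ e)⟩
      · exact ⟨fun e => h₁ (hl₀ e), fun e => h₀ (hl₁ e)⟩
    by_cases hs : s = 2 ∨ (s ≠ 3 ∧ r ≠ 3)
    · refine ⟨(k, r), ⟨hl, hl₀, hl₁⟩, fun _ => rfl, ?_, ?_⟩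
      · rcases hs with rfl | hs
        · by_cases hr : r = 3
          · exact Or.inr (Or.inr (Or.inr ⟨rfl, hr, rfl⟩))
          · exact Or.inl (Or.inl ⟨rfl, hsr, by simp, hr⟩)
        · exact Or.inl (Or.inl ⟨rfl, hsr, hs⟩)
      · rw [chainDist_of_eq, chainDist_of_eq]
        fin_cases s <;> fin_cases r <;> simp [triDist] at hs hsr ⊢ <;> norm_num
    · have hk'' : k ≠ 0 ∧ k ≠ h + 1 := by
        refine hk' ?_
        revert hs
        clear hk' hcd hk₀ hk₁ hl₀ hl₁
        revert s r
        decide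
      refine ⟨(k, 2), ⟨hk, fun e => absurd e hk''.1, fun e => absurd e hk''.2⟩, by simp, ?_, ?_⟩
      · simp only [ChainRel]
        fin_cases s <;> simp at hs ⊢
      · rw [chainDist_of_eq, chainDist_of_eq]
        fin_cases s <;> fin_cases r <;> simp [triDist] at hs hsr ⊢
  · by_cases hs : s = 0
    · subst hs
      obtain ⟨k, rfl⟩ : ∃ k', k = k' + 1 := ⟨k - 1, by omega⟩
      refine ⟨(k, 1), ⟨by simp; omega, by simp, fun e => ?_⟩, by simp,
        Or.inr (Or.inr (Or.inl ⟨rfl, rfl, rfl⟩)), ?_⟩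
      · simp at e
        omega
      rw [chainDist_of_gt _ _ _ hkl]
      obtain rfl | hkl' : k = l ∨ l < k := by omega
      · rw [chainDist_of_eq]
        fin_cases r <;> simp [distLeft, distRight, triDist]
        norm_num
      · rw [chainDist_of_gt _ _ _ hkl']
        simp [distLeft]
        ring
    · have hk' : k ≠ h + 1 := fun e => hs (hk₁ e)
      obtain ⟨s', hs', hrel, hdist⟩ : ∃ s', s' ≠ 3 ∧
          (ChainRel (k, s) (k, s') ∨ ChainRel (k, s') (k, s)) ∧
          distLeft (5 / 2) s = 5 / 2 + distLeft (5 / 2) s' := by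
        fin_cases s
        · exact absurd rfl hs
        · exact ⟨0, by decide, by simp [ChainRel], by simp [distLeft]; norm_num⟩
        · exact ⟨0, by decide, by simp [ChainRel], by simp [distLeft]; norm_num⟩
        · exact ⟨2, by decide, by simp [ChainRel], by simp [distLeft]⟩
      refine ⟨(k, s'), ⟨hk, fun e => ?_, fun e => absurd e hk'⟩, fun e => absurd e hs', hrel, ?_⟩
      · simp at e
        omega
      · rw [chainDist_of_gt _ _ _ hkl, chainDist_of_gt _ _ _ hkl, hdist]
        ring

/-! ## The gadgets of `G_α` -/

section Formula

variable (C : Fin m → Fin 3 → Fin n × Bool)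

theorem mem_occs (i : Fin n) (q : Fin m × Fin 3) : q ∈ occs C i ↔ (C q.1 q.2).1 = i := by
  have h : q ∈ (List.finRange m).product (List.finRange 3) :=
    List.mem_product.2 ⟨List.mem_finRange _, List.mem_finRange _⟩
  simp [occs, h]

theorem occs_nodup (i : Fin n) : (occs C i).Nodup :=
  (List.Nodup.product (List.nodup_finRange m) (List.nodup_finRange 3)).filter _

theorem literal_ext (hdist : DistinctVars C) {p q : Fin m × Fin 3} (h : p.1 = q.1)
    (h' : (C p.1 p.2).1 = (C q.1 q.2).1) : p = q := by
  obtain ⟨j, t⟩ := p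
  obtain ⟨j', t'⟩ := q
  obtain rfl : j = j' := h
  rw [hdist j t t' h']

theorem hocc_le (hdist : DistinctVars C) (i : Fin n) : hocc C i ≤ m := by
  have h : ((occs C i).map Prod.fst).Nodup := by
    refine (occs_nodup C i).map_on fun p hp q hq hpq => ?_
    rw [mem_occs] at hp hq
    exact literal_ext C hdist hpq (hp.trans hq.symm)
  simpa [hocc] using h.length_le_card

/-- The gadget containing a vertex. -/
def gadget : GV C → Fin n ⊕ Fin m
  | Sum.inl ⟨i, _⟩ => Sum.inl i
  | Sum.inr (j, _) => Sum.inr j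

/-- The clause-variable edges, in both directions. -/
def Link (a b : GV C) : Prop := cvRel C a b ∨ cvRel C b a

/-- The vertex of a variable gadget at which the clause-variable edge of its `k`-th triangle
ends. -/
def port (i : Fin n) (k : Fin (hocc C i)) : VarV C i :=
  if hk : (C ((occs C i).get k).1 ((occs C i).get k).2).2 = false then
    Sum.inr (Sum.inr ⟨k, hk⟩)
  else Sum.inl (k, 2)

theorem port_of_neg {i : Fin n} {k : Fin (hocc C i)}
    (hk : (C ((occs C i).get k).1 ((occs C i).get k).2).2 = false) :
    port C i k = Sum.inr (Sum.inr ⟨k, hk⟩) := dif_pos hk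

theorem port_of_pos {i : Fin n} {k : Fin (hocc C i)}
    (hk : (C ((occs C i).get k).1 ((occs C i).get k).2).2 = true) :
    port C i k = Sum.inl (k, 2) := dif_neg (by rw [hk]; decide)

theorem literal_var (i : Fin n) (k : Fin (hocc C i)) :
    (C ((occs C i).get k).1 ((occs C i).get k).2).1 = i :=
  (mem_occs C i _).1 (List.get_mem _ _)

theorem cvRel_iff (a b : GV C) : cvRel C a b ↔ ∃ (i : Fin n) (k : Fin (hocc C i)),
    a = cknob C ((occs C i).get k).1 ((occs C i).get k).2 ∧ b = Sum.inl ⟨i, port C i k⟩ := by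
  constructor
  · rintro ⟨j, t, k, hk, rfl, h⟩
    refine ⟨_, k, by rw [hk], ?_⟩
    rcases h with ⟨hk', rfl⟩ | ⟨ht, rfl⟩
    · rw [port_of_neg C hk']
      rfl
    · rw [port_of_pos C (by rw [hk]; exact ht)]
      rfl
  · rintro ⟨i, k, rfl, rfl⟩
    obtain ⟨j, t, hk⟩ : ∃ j t, (occs C i).get k = (j, t) := ⟨_, _, rfl⟩
    have hi : (C j t).1 = i := by simpa only [hk] using literal_var C i k
    subst hi
    refine ⟨j, t, k, hk, by rw [hk], ?_⟩
    rcases Bool.eq_false_or_eq_true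
      (C ((occs C (C j t).1).get k).1 ((occs C (C j t).1).get k).2).2 with hk' | hk'
    · refine Or.inr ⟨?_, ?_⟩
      · rwa [hk] at hk'
      · rw [port_of_pos C hk']
        rfl
    · refine Or.inl ⟨hk', ?_⟩
      rw [port_of_neg C hk']
      rfl

theorem port_injective {i i' : Fin n} {k : Fin (hocc C i)} {k' : Fin (hocc C i')}
    (h : (Sum.inl ⟨i, port C i k⟩ : GV C) = Sum.inl ⟨i', port C i' k'⟩) :
    (occs C i).get k = (occs C i').get k' := by
  have h₁ := Sum.inl.inj h
  obtain rfl : i = i' := congrArg Sigma.fst h₁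
  have h₂ : port C i k = port C i k' := by simpa using h₁
  have h₃ : k = k' := by
    rcases hk : (C ((occs C i).get k).1 ((occs C i).get k).2).2 with _ | _ <;>
      rcases hk' : (C ((occs C i).get k').1 ((occs C i).get k').2).2 with _ | _
    · rw [port_of_neg C hk, port_of_neg C hk'] at h₂
      exact congrArg Subtype.val (Sum.inr.inj (Sum.inr.inj h₂))
    · rw [port_of_neg C hk, port_of_pos C hk'] at h₂
      cases h₂
    · rw [port_of_pos C hk, port_of_neg C hk'] at h₂
      cases h₂
    · rw [port_of_pos C hk, port_of_pos C hk'] at h₂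
      exact congrArg Prod.fst (Sum.inl.inj h₂)
  rw [h₃]

theorem occurrence_unique {i : Fin n} {k k' : Fin (hocc C i)}
    (h : (occs C i).get k = (occs C i).get k') : k = k' :=
  (List.nodup_iff_injective_get.1 (occs_nodup C i)) h

theorem occurrence_unique_of_knob {i i' : Fin n} {k : Fin (hocc C i)} {k' : Fin (hocc C i')}
    (h : (occs C i).get k = (occs C i').get k') :
    (Sum.inl ⟨i, port C i k⟩ : GV C) = Sum.inl ⟨i', port C i' k'⟩ := by
  obtain rfl : i = i' := by rw [← literal_var C i k, ← literal_var C i' k', h]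
  rw [occurrence_unique C h]

theorem occurrence_unique_of_clause (hdist : DistinctVars C) {i : Fin n}
    {k k' : Fin (hocc C i)} (h : ((occs C i).get k).1 = ((occs C i).get k').1) : k = k' := by
  refine occurrence_unique C (literal_ext C hdist h ?_)
  rw [literal_var, literal_var]

theorem exists_occurrence (j : Fin m) (t : Fin 3) :
    ∃ k : Fin (hocc C (C j t).1), (occs C (C j t).1).get k = (j, t) :=
  List.mem_iff_get.1 ((mem_occs C _ (j, t)).2 rfl)

theorem exists_link (j : Fin m) (t : Fin 3) :
    ∃ p q : GV C, Link C p q ∧ gadget C p = Sum.inl (C j t).1 ∧ gadget C q = Sum.inr j := by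
  obtain ⟨k, hk⟩ := exists_occurrence C j t
  refine ⟨_, _, Or.inr ((cvRel_iff C _ _).2 ⟨_, k, rfl, rfl⟩), rfl, ?_⟩
  rw [hk]
  rfl

theorem Link.cases {p q : GV C} (h : Link C p q) :
    ∃ (i : Fin n) (k : Fin (hocc C i)),
      (p = cknob C ((occs C i).get k).1 ((occs C i).get k).2 ∧ q = Sum.inl ⟨i, port C i k⟩) ∨
      (q = cknob C ((occs C i).get k).1 ((occs C i).get k).2 ∧ p = Sum.inl ⟨i, port C i k⟩) := by
  rcases h with h | h
  · obtain ⟨i, k, h₁, h₂⟩ := (cvRel_iff C _ _).1 h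
    exact ⟨i, k, Or.inl ⟨h₁, h₂⟩⟩
  · obtain ⟨i, k, h₁, h₂⟩ := (cvRel_iff C _ _).1 h
    exact ⟨i, k, Or.inr ⟨h₁, h₂⟩⟩

theorem Link.gadget_ne {p q : GV C} (h : Link C p q) : gadget C p ≠ gadget C q := by
  obtain ⟨i, k, ⟨rfl, rfl⟩ | ⟨rfl, rfl⟩⟩ := h.cases <;> simp [gadget, cknob]

theorem far_iff (a b : GV C) :
    Far (gadget C) (Link C) a b ↔ shortRel C a b ∨ shortRel C b a := by
  have key : ∀ (i : Fin n) (j : Fin m),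
      (∃ p q, Link C p q ∧ gadget C p = Sum.inl i ∧ gadget C q = Sum.inr j) →
        ∃ t, (C j t).1 = i := by
    rintro i j ⟨p, q, h, hp, hq⟩
    obtain ⟨i', k, ⟨rfl, rfl⟩ | ⟨rfl, rfl⟩⟩ := h.cases
    · simp [gadget, cknob] at hp
    · obtain rfl : i' = i := by simpa [gadget] using hp
      obtain rfl : ((occs C i').get k).1 = j := by simpa [gadget, cknob] using hq
      exact ⟨_, literal_var C i' k⟩
  have key' : ∀ (p q : GV C) (e f : Fin n), Link C p q → gadget C p = Sum.inl e →
      gadget C q = Sum.inl f → False := by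
    intro p q e f h hp hq
    obtain ⟨i', k, ⟨rfl, rfl⟩ | ⟨rfl, rfl⟩⟩ := h.cases <;> simp [gadget, cknob] at hp hq
  have key'' : ∀ (p q : GV C) (e f : Fin m), Link C p q → gadget C p = Sum.inr e →
      gadget C q = Sum.inr f → False := by
    intro p q e f h hp hq
    obtain ⟨i', k, ⟨rfl, rfl⟩ | ⟨rfl, rfl⟩⟩ := h.cases <;> simp [gadget, cknob] at hp hq
  constructor
  · rintro ⟨h₁, h₂⟩
    rcases a with ⟨i, x⟩ | ⟨j, x⟩ <;> rcases b with ⟨i', y⟩ | ⟨j', y⟩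
    · exact Or.inl (Or.inl ⟨i, i', x, y, fun h => h₁ (by rw [gadget, gadget, h]), rfl, rfl⟩)
    · refine Or.inl (Or.inr (Or.inr ⟨i, x, j', y, ?_, rfl, rfl⟩))
      rintro t rfl
      obtain ⟨p, q, h, hp, hq⟩ := exists_link C j' t
      exact h₂ p q h ⟨hp, hq⟩
    · refine Or.inr (Or.inr (Or.inr ⟨i', y, j, x, ?_, rfl, rfl⟩))
      rintro t rfl
      obtain ⟨p, q, h, hp, hq⟩ := exists_link C j t
      exact h₂ q p h.symm ⟨hq, hp⟩
    · exact Or.inl (Or.inr (Or.inl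
        ⟨j, j', x, y, fun h => h₁ (by rw [gadget, gadget, h]), rfl, rfl⟩))
  · have hsymm : ∀ a b, Far (gadget C) (Link C) a b → Far (gadget C) (Link C) b a :=
      fun a b h => ⟨h.1.symm, fun p q hpq hc => h.2 q p hpq.symm hc.symm⟩
    have hfar : ∀ a b, shortRel C a b → Far (gadget C) (Link C) a b := by
      rintro a b (⟨i, i', x, y, h, rfl, rfl⟩ | ⟨j, j', x, y, h, rfl, rfl⟩ |
        ⟨i, x, j, y, h, rfl, rfl⟩)
      · exact ⟨by simpa [gadget] using h, fun p q hpq hc => key' p q _ _ hpq hc.1 hc.2⟩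
      · exact ⟨by simpa [gadget] using h, fun p q hpq hc => key'' p q _ _ hpq hc.1 hc.2⟩
      · refine ⟨by simp [gadget], fun p q hpq hc => ?_⟩
        obtain ⟨t, ht⟩ := key i j ⟨p, q, hpq, hc⟩
        exact h t ht
    rintro (h | h)
    · exact hfar a b h
    · exact hsymm b a (hfar b a h)

theorem isolated_iff (x : GV C) :
    Isolated (gadget C) (Link C) x ↔ ∃ i y, x = Sum.inl ⟨i, y⟩ ∧ hocc C i = 0 := by
  constructor
  · intro h
    rcases x with ⟨i, y⟩ | ⟨j, y⟩
    · refine ⟨i, y, rfl, ?_⟩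
      by_contra h0
      exact h _ _ (Or.inr ((cvRel_iff C _ _).2 ⟨i, ⟨0, Nat.pos_of_ne_zero h0⟩, rfl, rfl⟩)) rfl
    · obtain ⟨p, q, hl, -, hq⟩ := exists_link C j 0
      exact absurd hq (h q p hl.symm)
  · rintro ⟨i, y, rfl, h0⟩ p q hpq hp
    obtain ⟨i', k, ⟨rfl, rfl⟩ | ⟨rfl, rfl⟩⟩ := hpq.cases
    · simp [gadget, cknob] at hp
    · obtain rfl : i' = i := by simpa [gadget] using hp
      exact absurd k.isLt (by omega)

/-- The code of a vertex of a variable gadget. -/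
def vcode (i : Fin n) : VarV C i → ℕ × Fin 4
  | Sum.inl (k, x) => (k.val + 1, x.castSucc)
  | Sum.inr (Sum.inl false) => (0, 1)
  | Sum.inr (Sum.inl true) => (hocc C i + 1, 0)
  | Sum.inr (Sum.inr k) => (k.1.val + 1, 3)

theorem vcode_injective (i : Fin n) : Function.Injective (vcode C i) := by
  have h3 : ∀ x : Fin 3, x.castSucc ≠ 3 := by decide
  rintro (⟨k, x⟩ | (_ | _) | k) (⟨l, y⟩ | (_ | _) | l) h <;>
    simp only [vcode, Prod.mk.injEq] at h
  · obtain rfl : k = l := Fin.ext (by omega)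
    obtain rfl : x = y := Fin.castSucc_injective 3 h.2
    rfl
  · exact absurd h.1 (by omega)
  · exact absurd h.1 (by omega)
  · exact absurd h.2 (h3 x)
  · exact absurd h.1 (by omega)
  · rfl
  · exact absurd h.1 (by omega)
  · exact absurd h.1 (by omega)
  · exact absurd h.1 (by omega)
  · exact absurd h.1 (by omega)
  · rfl
  · exact absurd h.2 (by decide)
  · exact absurd h.2.symm (h3 y)
  · exact absurd h.1 (by omega)
  · exact absurd h.2 (by decide)
  · obtain rfl : k = l := Subtype.ext (Fin.ext (by omega))
    rfl

theorem vcode_valid (i : Fin n) (x : VarV C i) : ChainValid (hocc C i) (vcode C i x) := by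
  rcases x with ⟨k, x⟩ | (_ | _) | k
  · have := k.isLt
    refine ⟨?_, ?_, ?_⟩ <;> simp [vcode]; omega
  · simp [ChainValid, vcode]
  · simp [ChainValid, vcode]
  · have := k.1.isLt
    refine ⟨?_, ?_, ?_⟩ <;> simp [vcode]; omega

theorem varRel.cases {a b : GV C} (h : varRel C a b) :
    ∃ i x y, a = Sum.inl ⟨i, x⟩ ∧ b = Sum.inl ⟨i, y⟩ ∧ hocc C i ≠ 0 ∧
      (ChainRel (vcode C i x) (vcode C i y) ∨ ChainRel (vcode C i y) (vcode C i x)) := by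
  have h3 : ∀ x : Fin 3, x.castSucc ≠ 3 := by decide
  rcases h with ⟨i, k, x, y, h, rfl, rfl⟩ | ⟨i, k, k', h, rfl, rfl⟩ | ⟨i, k, h, rfl, rfl⟩ |
    ⟨i, k, h, rfl, rfl⟩ | ⟨i, k, hk, rfl, rfl⟩ <;> refine ⟨i, _, _, rfl, rfl, Fin.pos k |>.ne', ?_⟩
  · exact Or.inl (Or.inl ⟨rfl, fun h' => h (Fin.castSucc_injective 3 h'), h3 x, h3 y⟩)
  · exact Or.inl (Or.inr (Or.inl ⟨by simp [vcode, h], rfl, rfl⟩))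
  · exact Or.inl (Or.inr (Or.inl ⟨by simp [vcode, h], rfl, rfl⟩))
  · exact Or.inr (Or.inr (Or.inl ⟨by simp [vcode, h], rfl, rfl⟩))
  · exact Or.inl (Or.inr (Or.inr ⟨rfl, rfl, rfl⟩))

theorem exists_vcode {i : Fin n} {c : ℕ × Fin 4} (hc : ChainValid (hocc C i) c)
    (hc₃ : c.2 ≠ 3) : ∃ x, vcode C i x = c := by
  obtain ⟨k, s⟩ := c
  obtain ⟨hk, hk₀, hk₁⟩ : k ≤ hocc C i + 1 ∧ (k = 0 → s = 1) ∧ (k = hocc C i + 1 → s = 0) := hc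
  by_cases h₀ : k = 0
  · exact ⟨Sum.inr (Sum.inl false), by rw [h₀, hk₀ h₀]; rfl⟩
  by_cases h₁ : k = hocc C i + 1
  · exact ⟨Sum.inr (Sum.inl true), by rw [hk₁ h₁, h₁]; rfl⟩
  · refine ⟨Sum.inl (⟨k - 1, by omega⟩, s.castLT ?_), ?_⟩
    · have : s.val ≠ 3 := fun e => hc₃ (Fin.ext e)
      omega
    · exact Prod.ext (show k - 1 + 1 = k by omega) rfl

theorem varRel_of_chainRel {i : Fin n} (h0 : hocc C i ≠ 0) {x y : VarV C i}
    (h : ChainRel (vcode C i x) (vcode C i y)) :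
    varRel C (Sum.inl ⟨i, x⟩) (Sum.inl ⟨i, y⟩) ∨ varRel C (Sum.inl ⟨i, y⟩) (Sum.inl ⟨i, x⟩) := by
  have h3 : ∀ x : Fin 3, x.castSucc ≠ 3 := by decide
  have hx : ∀ x : Fin 3, (x.castSucc = 0 → x = 0) ∧ (x.castSucc = 1 → x = 1) ∧
      (x.castSucc = 2 → x = 2) := by decide
  rcases x with ⟨k, x⟩ | (_ | _) | k <;> rcases y with ⟨l, y⟩ | (_ | _) | l <;>
    rcases h with ⟨h₁, h₂, h₃, h₄⟩ | ⟨h₁, h₂, h₃⟩ | ⟨h₁, h₂, h₃⟩ <;> simp only [vcode] at *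
  all_goals
    try first
      | omega
      | contradiction
      | exact absurd h₂ (by decide)
      | exact absurd h₃ (by decide)
      | exact absurd h₂ (h3 _)
  · obtain rfl : k = l := Fin.ext (by omega)
    exact Or.inl (Or.inl ⟨i, k, x, y, fun e => h₂ (congrArg _ e), rfl, rfl⟩)
  · obtain rfl := (hx x).2.1 h₂
    obtain rfl := (hx y).1 h₃
    exact Or.inl (Or.inr (Or.inl ⟨i, k, l, by omega, rfl, rfl⟩))
  · obtain rfl := (hx x).2.1 h₂
    exact Or.inr (Or.inr (Or.inr (Or.inr (Or.inl ⟨i, k, by omega, rfl, rfl⟩))))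
  · obtain rfl := (hx y).1 h₃
    exact Or.inl (Or.inr (Or.inr (Or.inl ⟨i, l, by omega, rfl, rfl⟩)))
  · obtain rfl := (hx y).2.2 h₃
    obtain rfl : k.1 = l := Fin.ext (by omega)
    exact Or.inl (Or.inr (Or.inr (Or.inr (Or.inr ⟨i, k.1, k.2, rfl, rfl⟩))))

end Formula

/-! ## The edges and the weights of `G_α` -/

section Edges

variable (C : Fin m → Fin 3 → Fin n × Bool)

theorem not_varRel_inr (q : Fin m × ClauseV) (b : GV C) : ¬ varRel C (Sum.inr q) b := by
  rintro (⟨i, k, x, y, h, h', -⟩ | ⟨i, k, k', h, h', -⟩ | ⟨i, k, h, h', -⟩ | ⟨i, k, h, h', -⟩ |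
    ⟨i, k, hk, h', -⟩) <;> cases h'

/-- The cycle vertices of a clause gadget. -/
def cycleVertex (s : Fin 9) : ClauseV := Sum.inl (Sum.inl s)

/-- The knobs of a clause gadget. -/
def knobVertex (t : Fin 3) : ClauseV := Sum.inl (Sum.inr t)

/-- The centre of a clause gadget. -/
def centreVertex : ClauseV := Sum.inr ()

/-- The handles of a clause gadget. -/
def IsHandle (x y : ClauseV) : Prop := ∃ t, x = knobVertex t ∧ y = cycleVertex (anchor t)

/-- The cycle edges of a clause gadget. -/
def IsCycleEdge (x y : ClauseV) : Prop := ∃ s, x = cycleVertex s ∧ y = cycleVertex (s + 1)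

/-- The centre edges of a clause gadget. -/
def IsCentreEdge (x y : ClauseV) : Prop := ∃ s, x = centreVertex ∧ y = cycleVertex s

instance (x y : ClauseV) : Decidable (IsHandle x y) :=
  inferInstanceAs (Decidable (∃ t, x = knobVertex t ∧ y = cycleVertex (anchor t)))

instance (x y : ClauseV) : Decidable (IsCycleEdge x y) :=
  inferInstanceAs (Decidable (∃ s, x = cycleVertex s ∧ y = cycleVertex (s + 1)))

instance (x y : ClauseV) : Decidable (IsCentreEdge x y) :=
  inferInstanceAs (Decidable (∃ s, x = centreVertex ∧ y = cycleVertex s))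

theorem handleRel_iff (j : Fin m) (x y : ClauseV) :
    handleRel C (Sum.inr (j, x)) (Sum.inr (j, y)) ↔ IsHandle x y := by
  constructor
  · rintro ⟨j', t, h, h'⟩
    exact ⟨t, congrArg Prod.snd (Sum.inr.inj h), congrArg Prod.snd (Sum.inr.inj h')⟩
  · rintro ⟨t, rfl, rfl⟩
    exact ⟨j, t, rfl, rfl⟩

theorem cycleRel_iff (j : Fin m) (x y : ClauseV) :
    cycleRel C (Sum.inr (j, x)) (Sum.inr (j, y)) ↔ IsCycleEdge x y := by
  constructor
  · rintro ⟨j', s, h, h'⟩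
    exact ⟨s, congrArg Prod.snd (Sum.inr.inj h), congrArg Prod.snd (Sum.inr.inj h')⟩
  · rintro ⟨s, rfl, rfl⟩
    exact ⟨j, s, rfl, rfl⟩

theorem centreRel_iff (j : Fin m) (x y : ClauseV) :
    centreRel C (Sum.inr (j, x)) (Sum.inr (j, y)) ↔ IsCentreEdge x y := by
  constructor
  · rintro ⟨j', s, h, h'⟩
    exact ⟨s, congrArg Prod.snd (Sum.inr.inj h), congrArg Prod.snd (Sum.inr.inj h')⟩
  · rintro ⟨s, rfl, rfl⟩
    exact ⟨j, s, rfl, rfl⟩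

/-- The union of the edge relations inside the gadgets. -/
def InnerRel (a b : GV C) : Prop :=
  varRel C a b ∨ handleRel C a b ∨ cycleRel C a b ∨ centreRel C a b

theorem InnerRel.gadget_eq {a b : GV C} (h : InnerRel C a b) : gadget C a = gadget C b := by
  rcases h with h | ⟨j, t, rfl, rfl⟩ | ⟨j, s, rfl, rfl⟩ | ⟨j, s, rfl, rfl⟩
  · obtain ⟨i, x, y, rfl, rfl, -⟩ := varRel.cases C h
    rfl
  · rfl
  · rfl
  · rfl

theorem InnerRel.cases {a b : GV C} (h : InnerRel C a b) :
    (∃ i x y, a = Sum.inl ⟨i, x⟩ ∧ b = Sum.inl ⟨i, y⟩ ∧ hocc C i ≠ 0 ∧ varRel C a b ∧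
      (ChainRel (vcode C i x) (vcode C i y) ∨ ChainRel (vcode C i y) (vcode C i x))) ∨
    (∃ j x y, a = Sum.inr (j, x) ∧ b = Sum.inr (j, y) ∧
      0 < clauseWeight₀ x y ∧ 0 < clauseWeight₀ y x) := by
  rcases h with h | ⟨j, t, rfl, rfl⟩ | ⟨j, s, rfl, rfl⟩ | ⟨j, s, rfl, rfl⟩
  · obtain ⟨i, x, y, rfl, rfl, h₀, h'⟩ := varRel.cases C h
    exact Or.inl ⟨i, x, y, rfl, rfl, h₀, h, h'⟩
  · refine Or.inr ⟨j, _, _, rfl, rfl, ?_⟩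
    simp [clauseWeight₀, clauseWeight, anchor]
  · refine Or.inr ⟨j, _, _, rfl, rfl, ?_⟩
    simp [clauseWeight_cycle]
  · refine Or.inr ⟨j, _, _, rfl, rfl, ?_⟩
    simp [clauseWeight₀, clauseWeight]

theorem adj_iff (a b : GV C) : (Galpha C).Adj a b ↔ a ≠ b ∧
    (InnerRel C a b ∨ InnerRel C b a ∨ Link C a b ∨ shortRel C a b ∨ shortRel C b a) := by
  rw [Galpha, SimpleGraph.fromRel_adj]
  simp only [InnerRel, Link]
  tauto

theorem adj_same {a b : GV C} (h : (Galpha C).Adj a b) (hg : gadget C a = gadget C b) :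
    InnerRel C a b ∨ InnerRel C b a := by
  rcases ((adj_iff C a b).1 h).2 with h | h | h | h
  · exact Or.inl h
  · exact Or.inr h
  · exact absurd hg (Link.gadget_ne C h)
  · exact absurd hg ((far_iff C a b).2 h).1

theorem adj_same_cases {a b : GV C} (h : (Galpha C).Adj a b) (hg : gadget C a = gadget C b) :
    (∃ i x y, a = Sum.inl ⟨i, x⟩ ∧ b = Sum.inl ⟨i, y⟩ ∧ hocc C i ≠ 0 ∧
      (varRel C a b ∨ varRel C b a) ∧
      (ChainRel (vcode C i x) (vcode C i y) ∨ ChainRel (vcode C i y) (vcode C i x))) ∨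
    (∃ j x y, a = Sum.inr (j, x) ∧ b = Sum.inr (j, y) ∧ 0 < clauseWeight₀ x y) := by
  rcases adj_same C h hg with h | h
  · obtain ⟨i, x, y, h₁, h₂, h₀, h₃, h₄⟩ | ⟨j, x, y, h₁, h₂, h₃, -⟩ := h.cases
    · exact Or.inl ⟨i, x, y, h₁, h₂, h₀, Or.inl h₃, h₄⟩
    · exact Or.inr ⟨j, x, y, h₁, h₂, h₃⟩
  · obtain ⟨i, x, y, h₁, h₂, h₀, h₃, h₄⟩ | ⟨j, x, y, h₁, h₂, -, h₃⟩ := h.cases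
    · exact Or.inl ⟨i, y, x, h₂, h₁, h₀, Or.inr h₃, h₄.symm⟩
    · exact Or.inr ⟨j, y, x, h₂, h₁, h₃⟩

theorem galpha_isGadgetGraph (hdist : DistinctVars C) :
    IsGadgetGraph (Galpha C) (gadget C) (Link C) where
  adj_cases a b h := by
    rcases ((adj_iff C a b).1 h).2 with h | h | h | h
    · exact Or.inl (InnerRel.gadget_eq C h)
    · exact Or.inl (InnerRel.gadget_eq C h).symm
    · exact Or.inr (Or.inl h)
    · exact Or.inr (Or.inr ((far_iff C a b).2 h))
  adj_of_far a b h :=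
    (adj_iff C a b).2 ⟨fun e => h.1 (congrArg _ e),
      Or.inr (Or.inr (Or.inr ((far_iff C a b).1 h)))⟩
  adj_of_link a b h :=
    (adj_iff C a b).2 ⟨fun e => Link.gadget_ne C h (congrArg _ e), Or.inr (Or.inr (Or.inl h))⟩
  symm _ _ h := h.symm
  ne _ _ h := Link.gadget_ne C h
  unique p q p' q' h h' hp hq := by
    have key : ∀ (i i' : Fin n) (k : Fin (hocc C i)) (k' : Fin (hocc C i')), i = i' →
        ((occs C i).get k).1 = ((occs C i').get k').1 →
        (occs C i).get k = (occs C i').get k' := by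
      rintro i i' k k' rfl h
      rw [occurrence_unique_of_clause C hdist h]
    obtain ⟨i, k, ⟨rfl, rfl⟩ | ⟨rfl, rfl⟩⟩ := Link.cases C h <;>
      obtain ⟨i', k', ⟨rfl, rfl⟩ | ⟨rfl, rfl⟩⟩ := Link.cases C h'
    · have e := key i i' k k' (Sum.inl.inj hq) (Sum.inr.inj hp)
      exact ⟨by rw [e], occurrence_unique_of_knob C e⟩
    · cases hp
    · cases hp
    · have e := key i i' k k' (Sum.inl.inj hp) (Sum.inr.inj hq)
      exact ⟨occurrence_unique_of_knob C e, by rw [e]⟩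
  matching p q q' h h' := by
    obtain ⟨i, k, ⟨rfl, rfl⟩ | ⟨rfl, rfl⟩⟩ := Link.cases C h <;>
      obtain ⟨i', k', ⟨hp, rfl⟩ | ⟨rfl, hp⟩⟩ := Link.cases C h'
    · have e : (occs C i).get k = (occs C i').get k' := by
        have e' := Sum.inr.inj hp
        exact Prod.ext (Prod.mk.inj e').1 (Sum.inr.inj (Sum.inl.inj (Prod.mk.inj e').2))
      exact occurrence_unique_of_knob C e
    · cases hp
    · cases hp
    · rw [port_injective C hp]

theorem ωα_link {a b : GV C} (h : Link C a b) : ωα C a b = 5 * m + 20 := by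
  have h₁ : ¬ InnerRel C a b := fun h' => Link.gadget_ne C h h'.gadget_eq
  have h₂ : ¬ InnerRel C b a := fun h' => Link.gadget_ne C h h'.gadget_eq.symm
  simp only [InnerRel, not_or] at h₁ h₂
  have h' : cvRel C a b ∨ cvRel C b a := h
  simp only [ωα, h₁, h₂, h', or_false, if_false, if_true]

theorem ωα_far {a b : GV C} (h : Far (gadget C) (Link C) a b) :
    ωα C a b = 2 * (5 * m + 20) := by
  have h₁ : ¬ InnerRel C a b := fun h' => h.1 h'.gadget_eq
  have h₂ : ¬ InnerRel C b a := fun h' => h.1 h'.gadget_eq.symm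
  simp only [InnerRel, not_or] at h₁ h₂
  have h₃ : ¬ (cvRel C a b ∨ cvRel C b a) := h.not_link
  have h₄ := (far_iff C a b).1 h
  simp only [ωα, h₁, h₂, h₃, h₄, or_false, if_false, if_true]

theorem ωα_var {a b : GV C} (h : varRel C a b ∨ varRel C b a) : ωα C a b = 5 / 2 := by
  rw [ωα, if_pos (by tauto)]
  norm_num

/-- The edges of a clause gadget are the handles, the edges of the cycle, and the centre edges. -/
theorem clauseWeight_cases (x y : ClauseV) (h : 0 < clauseWeight₀ x y) :
    x ≠ y ∧
    ((IsHandle x y ∨ IsHandle y x) ∧ clauseWeight₀ x y = 25 ∨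
    ¬ (IsHandle x y ∨ IsHandle y x) ∧
      (IsCycleEdge x y ∨ IsCycleEdge y x) ∧ clauseWeight₀ x y = 36 ∨
    ¬ (IsHandle x y ∨ IsHandle y x) ∧ ¬ (IsCycleEdge x y ∨ IsCycleEdge y x) ∧
      (IsCentreEdge x y ∨ IsCentreEdge y x) ∧ clauseWeight₀ x y = 60) := by
  revert x y
  decide +kernel

theorem adj_clause (j : Fin m) {x y : ClauseV} (h : 0 < clauseWeight₀ x y) :
    (Galpha C).Adj (Sum.inr (j, x)) (Sum.inr (j, y)) := by
  have key : ∀ x y : ClauseV, IsHandle x y ∨ IsCycleEdge x y ∨ IsCentreEdge x y →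
      InnerRel C (Sum.inr (j, x)) (Sum.inr (j, y)) := fun x y h => Or.inr <|
    h.imp (handleRel_iff C j x y).2 (Or.imp (cycleRel_iff C j x y).2 (centreRel_iff C j x y).2)
  obtain ⟨hne, h'⟩ := clauseWeight_cases x y h
  refine (adj_iff C _ _).2 ⟨fun e => hne (Prod.mk.inj (Sum.inr.inj e)).2, ?_⟩
  obtain ⟨h₁ | h₁, -⟩ | ⟨-, h₁ | h₁, -⟩ | ⟨-, -, h₁ | h₁, -⟩ := h'
  · exact Or.inl (key _ _ (Or.inl h₁))
  · exact Or.inr (Or.inl (key _ _ (Or.inl h₁)))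
  · exact Or.inl (key _ _ (Or.inr (Or.inl h₁)))
  · exact Or.inr (Or.inl (key _ _ (Or.inr (Or.inl h₁))))
  · exact Or.inl (key _ _ (Or.inr (Or.inr h₁)))
  · exact Or.inr (Or.inl (key _ _ (Or.inr (Or.inr h₁))))

theorem ωα_eq {a b : GV C} (hab : ¬ varRel C a b) (hba : ¬ varRel C b a) {w : ℕ}
    (h : (handleRel C a b ∨ handleRel C b a) ∧ w = 25 ∨
      ¬ (handleRel C a b ∨ handleRel C b a) ∧ (cycleRel C a b ∨ cycleRel C b a) ∧ w = 36 ∨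
      ¬ (handleRel C a b ∨ handleRel C b a) ∧ ¬ (cycleRel C a b ∨ cycleRel C b a) ∧
        (centreRel C a b ∨ centreRel C b a) ∧ w = 60) : ωα C a b = w / 10 := by
  have h' : ¬ (handleRel C a b ∨ handleRel C b a) →
      ¬ (varRel C a b ∨ varRel C b a ∨ handleRel C a b ∨ handleRel C b a) := fun h h' =>
    h'.elim hab fun h' => h'.elim hba h
  rw [ωα]
  obtain ⟨h₁, rfl⟩ | ⟨h₁, h₂, rfl⟩ | ⟨h₁, h₂, h₃, rfl⟩ := h
  · rw [if_pos (Or.inr (Or.inr h₁))]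
    norm_num
  · rw [if_neg (h' h₁), if_pos h₂]
    norm_num
  · rw [if_neg (h' h₁), if_neg h₂, if_pos h₃]
    norm_num

theorem ωα_clause (j : Fin m) {x y : ClauseV} (h : 0 < clauseWeight₀ x y) :
    ωα C (Sum.inr (j, x)) (Sum.inr (j, y)) = clauseWeight₀ x y / 10 := by
  have h' := (clauseWeight_cases x y h).2
  rw [← handleRel_iff C j x y, ← handleRel_iff C j y x, ← cycleRel_iff C j x y,
    ← cycleRel_iff C j y x, ← centreRel_iff C j x y, ← centreRel_iff C j y x] at h'
  exact ωα_eq C (not_varRel_inr C _ _) (not_varRel_inr C _ _) h'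

end Edges

/-! ## The distances in `G_α` -/

section Distances

variable (C : Fin m → Fin 3 → Fin n × Bool)

open Classical in
/-- The distances in the gadgets of `G_α`, where `a i` is the weight in the variable gadget of
`x_i` and `dc j` are the distances in the gadget of `C_j`. -/
noncomputable def galphaDist (a : Fin n → ℝ) (dc : Fin m → ClauseV → ClauseV → ℝ) :
    GV C → GV C → ℝ
  | Sum.inl ⟨i, x⟩, Sum.inl ⟨i', y⟩ =>
    if hocc C i = 0 then if vcode C i x = vcode C i' y then 0 else 4 * (5 * m + 20)
    else chainDist (a i) (vcode C i x) (vcode C i' y)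
  | Sum.inr (j, x), Sum.inr (_, y) => dc j x y
  | _, _ => 0

theorem galphaDist_var {a : Fin n → ℝ} {dc : Fin m → ClauseV → ClauseV → ℝ} {i : Fin n}
    (h : hocc C i ≠ 0) (x y : VarV C i) :
    galphaDist C a dc (Sum.inl ⟨i, x⟩) (Sum.inl ⟨i, y⟩) =
      chainDist (a i) (vcode C i x) (vcode C i y) := if_neg h

theorem galphaDist_isolated {a : Fin n → ℝ} {dc : Fin m → ClauseV → ClauseV → ℝ} {i : Fin n}
    (h : hocc C i = 0) (x y : VarV C i) :
    galphaDist C a dc (Sum.inl ⟨i, x⟩) (Sum.inl ⟨i, y⟩) =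
      if vcode C i x = vcode C i y then (0 : ℝ) else 4 * (5 * (m : ℝ) + 20) := if_pos h

/-- Two vertices of the same gadget. -/
theorem gadget_eq_cases {a b : GV C} (h : gadget C a = gadget C b) :
    (∃ i x y, a = Sum.inl ⟨i, x⟩ ∧ b = Sum.inl ⟨i, y⟩) ∨
    (∃ j x y, a = Sum.inr (j, x) ∧ b = Sum.inr (j, y)) := by
  rcases a with ⟨i, x⟩ | ⟨j, x⟩ <;> rcases b with ⟨i', y⟩ | ⟨j', y⟩
  · obtain rfl : i = i' := Sum.inl.inj h
    exact Or.inl ⟨i, x, y, rfl, rfl⟩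
  · cases h
  · cases h
  · obtain rfl : j = j' := Sum.inr.inj h
    exact Or.inr ⟨j, x, y, rfl, rfl⟩

theorem Link.cases_gadgets {p q x v : GV C} (h : Link C p q) (hx : gadget C x = gadget C p)
    (hv : gadget C v = gadget C q) : ∃ (i : Fin n) (k : Fin (hocc C i)) (y : VarV C i)
      (z : ClauseV),
      (p = cknob C ((occs C i).get k).1 ((occs C i).get k).2 ∧ q = Sum.inl ⟨i, port C i k⟩ ∧
        x = Sum.inr (((occs C i).get k).1, z) ∧ v = Sum.inl ⟨i, y⟩) ∨
      (q = cknob C ((occs C i).get k).1 ((occs C i).get k).2 ∧ p = Sum.inl ⟨i, port C i k⟩ ∧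
        v = Sum.inr (((occs C i).get k).1, z) ∧ x = Sum.inl ⟨i, y⟩) := by
  have hc : ∀ (a : GV C) (j : Fin m), gadget C a = Sum.inr j → ∃ z, a = Sum.inr (j, z) := by
    rintro (⟨i, y⟩ | ⟨j, z⟩) j' h
    · cases h
    · exact ⟨z, by rw [Sum.inr.inj h]⟩
  have hi : ∀ (a : GV C) (i : Fin n), gadget C a = Sum.inl i → ∃ y, a = Sum.inl ⟨i, y⟩ := by
    rintro (⟨i, y⟩ | ⟨j, z⟩) i' h
    · obtain rfl : i = i' := Sum.inl.inj h
      exact ⟨y, rfl⟩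
    · cases h
  obtain ⟨i, k, ⟨rfl, rfl⟩ | ⟨rfl, rfl⟩⟩ := Link.cases C h
  · obtain ⟨z, rfl⟩ := hc _ _ hx
    obtain ⟨y, rfl⟩ := hi _ _ hv
    exact ⟨i, k, y, z, Or.inl ⟨rfl, rfl, rfl, rfl⟩⟩
  · obtain ⟨z, rfl⟩ := hc _ _ hv
    obtain ⟨y, rfl⟩ := hi _ _ hx
    exact ⟨i, k, y, z, Or.inr ⟨rfl, rfl, rfl, rfl⟩⟩

theorem galpha_isGadgetMetric (hdist : DistinctVars C) {a : Fin n → ℝ}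
    {dc : Fin m → ClauseV → ClauseV → ℝ} {w : GV C → GV C → ℝ}
    {T : GV C → GV C → GV C → Prop} (ha₂ : ∀ i, 2 ≤ a i) (ha₃ : ∀ i, a i ≤ 3)
    (hself : ∀ j x, dc j x x = 0) (hpos : ∀ j x y, x ≠ y → 0 < dc j x y)
    (hle : ∀ j x y, dc j x y ≤ 16)
    (hlink : ∀ x y, Link C x y → w x y = 5 * m + 20)
    (hfar : ∀ x y, Far (gadget C) (Link C) x y → w x y = 2 * (5 * m + 20))
    (hinner : ∀ x y, (Galpha C).Adj x y → gadget C x = gadget C y → 1 ≤ w x y)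
    (htight : ∀ v x y, (Galpha C).Adj x y → gadget C x = gadget C y → gadget C x = gadget C v →
      (T v x y → galphaDist C a dc x v = w x y + galphaDist C a dc y v) ∧
      (¬ T v x y → galphaDist C a dc x v < w x y + galphaDist C a dc y v)) :
    IsGadgetMetric (Galpha C) (gadget C) (Link C) (5 * m + 20) T w (galphaDist C a dc) := by
  have hvar : ∀ (i : Fin n) (x y : VarV C i), hocc C i ≠ 0 →
      galphaDist C a dc (Sum.inl ⟨i, x⟩) (Sum.inl ⟨i, y⟩) ≤ 5 * m + 3 := by
    intro i x y h
    have h₁ := chainDist_le (ha₂ i) (ha₃ i) h (vcode_valid C i x) (vcode_valid C i y)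
    have h₂ : (hocc C i : ℝ) ≤ m := by exact_mod_cast hocc_le C hdist i
    rw [galphaDist_var C h]
    linarith
  have hclause : ∀ (j : Fin m) (x y : ClauseV),
      galphaDist C a dc (Sum.inr (j, x)) (Sum.inr (j, y)) ≤ 16 := hle
  have hm : (0 : ℝ) ≤ m := Nat.cast_nonneg m
  refine ⟨hlink, hfar, hinner, ?_, ?_, ?_, ?_, ?_, htight⟩
  · rintro (⟨i, x⟩ | ⟨j, x⟩)
    · by_cases h : hocc C i = 0
      · rw [galphaDist_isolated C h, if_pos rfl]
      · rw [galphaDist_var C h, chainDist_self]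
    · exact hself j x
  · intro p q hpq hne
    rcases gadget_eq_cases C hpq with ⟨i, x, y, rfl, rfl⟩ | ⟨j, x, y, rfl, rfl⟩
    · have hxy : vcode C i x ≠ vcode C i y := fun e => hne (by rw [vcode_injective C i e])
      by_cases h : hocc C i = 0
      · rw [galphaDist_isolated C h, if_neg hxy]
        linarith
      · rw [galphaDist_var C h]
        exact chainDist_pos (ha₂ i) (ha₃ i) hxy
    · exact hpos j x y fun e => hne (by rw [e])
  · intro p q x v hpq hx hv
    obtain ⟨i, k, y, z, ⟨rfl, rfl, rfl, rfl⟩ | ⟨rfl, rfl, rfl, rfl⟩⟩ :=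
      Link.cases_gadgets C hpq hx hv
    · have h₁ := hvar i (port C i k) y k.pos.ne'
      have h₂ := hclause ((occs C i).get k).1 z (Sum.inl (Sum.inr ((occs C i).get k).2))
      unfold cknob
      linarith
    · have h₁ := hvar i y (port C i k) k.pos.ne'
      have h₂ := hclause ((occs C i).get k).1 (Sum.inl (Sum.inr ((occs C i).get k).2)) z
      unfold cknob
      linarith
  · intro x y hI h
    rcases gadget_eq_cases C h with ⟨i, x', y', rfl, rfl⟩ | ⟨j, x', y', rfl, rfl⟩
    · have := hvar i x' y' fun h0 => hI ((isolated_iff C _).2 ⟨i, x', rfl, h0⟩)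
      linarith
    · have := hclause j x' y'
      linarith
  · intro x y hI h hne
    obtain ⟨i, x', rfl, h0⟩ := (isolated_iff C x).1 hI
    rcases gadget_eq_cases C h with ⟨i', x'', y', h₁, rfl⟩ | ⟨_, _, _, h₁, -⟩
    swap
    · cases h₁
    obtain rfl : i = i' := congrArg Sigma.fst (Sum.inl.inj h₁)
    exact (galphaDist_isolated C h0 x' y').trans (if_neg fun e => hne
      (congrArg (fun z => (Sum.inl ⟨i, z⟩ : GV C)) (vcode_injective C i e)))

end Distances

/-! ## The rounding given by an assignment -/

section Rounding

variable (C : Fin m → Fin 3 → Fin n × Bool) (ψ : Fin n → Bool)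

/-- The truth value of the `t`-th literal of `C_j`. -/
def litValue (j : Fin m) (t : Fin 3) : Bool :=
  if (C j t).2 then ψ (C j t).1 else !(ψ (C j t).1)

open Classical in
/-- The rounding of `G_α` given by an assignment. -/
noncomputable def roundedWeight : GV C → GV C → ℕ
  | Sum.inl ⟨i, x⟩, Sum.inl ⟨i', y⟩ =>
    if i = i' then chainWeight (handleRound (ψ i)) (vcode C i x) (vcode C i' y)
    else 2 * (5 * m + 20)
  | Sum.inr (j, x), Sum.inr (j', y) =>
    if j = j' then clauseWeight₁ (litValue C ψ j) x y else 2 * (5 * m + 20)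
  | Sum.inl ⟨i, _⟩, Sum.inr (j, _) =>
    if ∃ t, (C j t).1 = i then 5 * m + 20 else 2 * (5 * m + 20)
  | Sum.inr (j, _), Sum.inl ⟨i, _⟩ =>
    if ∃ t, (C j t).1 = i then 5 * m + 20 else 2 * (5 * m + 20)

theorem roundedWeight_var (i : Fin n) (x y : VarV C i) :
    roundedWeight C ψ (Sum.inl ⟨i, x⟩) (Sum.inl ⟨i, y⟩) =
      chainWeight (handleRound (ψ i)) (vcode C i x) (vcode C i y) := if_pos rfl

theorem roundedWeight_clause (j : Fin m) (x y : ClauseV) :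
    roundedWeight C ψ (Sum.inr (j, x)) (Sum.inr (j, y)) =
      clauseWeight₁ (litValue C ψ j) x y := if_pos rfl

theorem roundedWeight_comm (a b : GV C) : roundedWeight C ψ a b = roundedWeight C ψ b a := by
  rcases a with ⟨i, x⟩ | ⟨j, x⟩ <;> rcases b with ⟨i', y⟩ | ⟨j', y⟩
  · by_cases h : i = i'
    · subst h
      exact (roundedWeight_var C ψ i x y).trans
        ((chainWeight_comm _ _ _).trans (roundedWeight_var C ψ i y x).symm)
    · exact (if_neg h).trans (if_neg fun e => h e.symm).symm
  · rfl
  · rfl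
  · by_cases h : j = j'
    · subst h
      exact (roundedWeight_clause C ψ j x y).trans
        ((clauseWeight_comm _ _ _).trans (roundedWeight_clause C ψ j y x).symm)
    · exact (if_neg h).trans (if_neg fun e => h e.symm).symm

theorem roundedWeight_link {a b : GV C} (h : Link C a b) :
    roundedWeight C ψ a b = 5 * m + 20 := by
  obtain ⟨i, k, ⟨rfl, rfl⟩ | ⟨rfl, rfl⟩⟩ := h.cases
  · exact if_pos ⟨_, literal_var C i k⟩
  · exact if_pos ⟨_, literal_var C i k⟩

theorem roundedWeight_far {a b : GV C} (h : Far (gadget C) (Link C) a b) :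
    roundedWeight C ψ a b = 2 * (5 * m + 20) := by
  have key : ∀ a b : GV C, shortRel C a b → roundedWeight C ψ a b = 2 * (5 * m + 20) := by
    rintro a b (⟨i, i', x, y, h, rfl, rfl⟩ | ⟨j, j', x, y, h, rfl, rfl⟩ |
      ⟨i, x, j, y, h, rfl, rfl⟩)
    · exact if_neg h
    · exact if_neg h
    · exact if_neg fun ⟨t, ht⟩ => h t ht
  rcases (far_iff C a b).1 h with h | h
  · exact key a b h
  · exact (roundedWeight_comm C ψ a b).trans (key b a h)

theorem handleRound_mem (b : Bool) : 2 ≤ handleRound b ∧ handleRound b ≤ 3 := by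
  cases b <;> decide

/-- The distances in the gadgets of `G_α`. -/
noncomputable def dist₀ : GV C → GV C → ℝ :=
  galphaDist C (fun _ => 5 / 2) fun _ x y => (clauseDist₀ x y : ℝ) / 10

/-- The rounded distances in the gadgets of `G_α`. -/
noncomputable def dist₁ : GV C → GV C → ℝ :=
  galphaDist C (fun i => handleRound (ψ i)) fun j x y => (clauseDist₁ (litValue C ψ j) x y : ℝ)

variable {ψ} in
/-- An inner edge is tight for the original distances if and only if it is tight for the rounded
distances. -/
theorem dist_edge (hψ : Satisfies C ψ) {v x y : GV C} (h : (Galpha C).Adj x y)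
    (hxy : gadget C x = gadget C y) (hxv : gadget C x = gadget C v) :
    (dist₀ C x v = ωα C x y + dist₀ C y v ∧
      dist₁ C ψ x v = roundedWeight C ψ x y + dist₁ C ψ y v) ∨
    (dist₀ C x v < ωα C x y + dist₀ C y v ∧
      dist₁ C ψ x v < roundedWeight C ψ x y + dist₁ C ψ y v) := by
  rcases adj_same_cases C h hxy with ⟨i, x', y', rfl, rfl, h0, hr, hc⟩ | ⟨j, x', y', rfl, rfl, hw⟩
  · rcases gadget_eq_cases C hxv with ⟨i', x'', v', h₁, rfl⟩ | ⟨_, _, _, h₁, -⟩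
    swap
    · cases h₁
    obtain rfl : i = i' := congrArg Sigma.fst (Sum.inl.inj h₁)
    have key := chainDist_edge (handleRound_mem (ψ i)).1 (handleRound_mem (ψ i)).2
      (vcode C i v') _ _ hc
    rw [ωα_var C hr, roundedWeight_var]
    simp only [dist₀, dist₁]
    rw [galphaDist_var C h0, galphaDist_var C h0, galphaDist_var C h0, galphaDist_var C h0]
    exact key
  · rcases gadget_eq_cases C hxv with ⟨_, _, _, h₁, -⟩ | ⟨j', x'', v', h₁, rfl⟩
    · cases h₁
    obtain rfl : j = j' := congrArg Prod.fst (Sum.inr.inj h₁)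
    rw [ωα_clause C j hw, roundedWeight_clause]
    have h₀ : ∀ z z', dist₀ C (Sum.inr (j, z)) (Sum.inr (j, z')) = (clauseDist₀ z z' : ℝ) / 10 :=
      fun _ _ => rfl
    have h₁ : ∀ z z', dist₁ C ψ (Sum.inr (j, z)) (Sum.inr (j, z')) =
      (clauseDist₁ (litValue C ψ j) z z' : ℝ) := fun _ _ => rfl
    simp only [h₀, h₁]
    rcases clauseDist_edge _ (hψ j) v' x' y' hw with ⟨h₂, h₃⟩ | ⟨h₂, h₃⟩
    · refine Or.inl ⟨?_, by exact_mod_cast h₃⟩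
      have : (clauseDist₀ x' v' : ℝ) = clauseWeight₀ x' y' + clauseDist₀ y' v' := by
        exact_mod_cast h₂
      linarith
    · refine Or.inr ⟨?_, by exact_mod_cast h₃⟩
      have : (clauseDist₀ x' v' : ℝ) < clauseWeight₀ x' y' + clauseDist₀ y' v' := by
        exact_mod_cast h₂
      linarith

theorem weight_inner {x y : GV C} (h : (Galpha C).Adj x y) (hxy : gadget C x = gadget C y) :
    1 ≤ ωα C x y ∧ 1 ≤ roundedWeight C ψ x y := by
  rcases adj_same_cases C h hxy with ⟨i, x', y', rfl, rfl, h0, hr, hc⟩ | ⟨j, x', y', rfl, rfl, hw⟩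
  · rw [ωα_var C hr, roundedWeight_var]
    obtain ⟨h₂, h₃⟩ := handleRound_mem (ψ i)
    refine ⟨by norm_num, ?_⟩
    unfold chainWeight
    split_ifs <;> omega
  · obtain ⟨h₀, h₁⟩ := clauseWeight_pos (litValue C ψ j) x' y' hw
    rw [ωα_clause C j hw, roundedWeight_clause]
    have : (10 : ℝ) ≤ clauseWeight₀ x' y' := by exact_mod_cast h₀
    exact ⟨by linarith, h₁⟩

variable {ψ} in
theorem isGadgetMetric_ωα (hdist : DistinctVars C) (hψ : Satisfies C ψ) :
    IsGadgetMetric (Galpha C) (gadget C) (Link C) (5 * m + 20)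
      (fun v x y => dist₀ C x v = ωα C x y + dist₀ C y v) (ωα C) (dist₀ C) := by
  refine galpha_isGadgetMetric C hdist (fun _ => by norm_num) (fun _ => by norm_num) ?_ ?_ ?_
    (fun _ _ => ωα_link C) (fun _ _ => ωα_far C)
    (fun x y h hxy => (weight_inner C ψ h hxy).1) ?_
  · intro j x
    simp [(clauseDist_self (litValue C ψ j) x).1]
  · intro j x y hxy
    have : (0 : ℝ) < clauseDist₀ x y := by
      exact_mod_cast (clauseDist_pos (litValue C ψ j) x y hxy).1
    linarith
  · intro j x y
    have : (clauseDist₀ x y : ℝ) ≤ 160 := by exact_mod_cast (clauseDist_le _ (hψ j) x y).1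
    linarith
  · intro v x y h hxy hxv
    refine ⟨id, fun hT => ?_⟩
    exact (dist_edge C hψ h hxy hxv).elim (fun h' => absurd h'.1 hT) And.left

variable {ψ} in
theorem isGadgetMetric_roundedWeight (hdist : DistinctVars C) (hψ : Satisfies C ψ) :
    IsGadgetMetric (Galpha C) (gadget C) (Link C) (5 * m + 20)
      (fun v x y => dist₀ C x v = ωα C x y + dist₀ C y v)
      (fun a b => (roundedWeight C ψ a b : ℝ)) (dist₁ C ψ) := by
  refine galpha_isGadgetMetric C hdist (fun i => ?_) (fun i => ?_) ?_ ?_ ?_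
    (fun a b h => ?_) (fun a b h => ?_) (fun x y h hxy => ?_) ?_
  · exact_mod_cast (handleRound_mem (ψ i)).1
  · exact_mod_cast (handleRound_mem (ψ i)).2
  · intro j x
    exact_mod_cast (clauseDist_self (litValue C ψ j) x).2
  · intro j x y hxy
    exact_mod_cast (clauseDist_pos (litValue C ψ j) x y hxy).2
  · intro j x y
    exact_mod_cast (clauseDist_le _ (hψ j) x y).2
  · exact_mod_cast roundedWeight_link C ψ h
  · exact_mod_cast roundedWeight_far C ψ h
  · exact_mod_cast (weight_inner C ψ h hxy).2
  · intro v x y h hxy hxv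
    rcases dist_edge C hψ h hxy hxv with h' | h'
    · exact ⟨fun _ => h'.2, fun hT => absurd h'.1 hT⟩
    · exact ⟨fun hT => absurd hT h'.1.ne, fun _ => h'.2⟩

theorem exists_tight {v x : GV C} (hxv : gadget C x = gadget C v) (hne : x ≠ v)
    (hI : ¬ Isolated (gadget C) (Link C) x) :
    ∃ y, (Galpha C).Adj x y ∧ gadget C x = gadget C y ∧
      dist₀ C x v = ωα C x y + dist₀ C y v := by
  rcases gadget_eq_cases C hxv with ⟨i, x', v', rfl, rfl⟩ | ⟨j, x', v', rfl, rfl⟩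
  · have h0 : hocc C i ≠ 0 := fun h0 => hI ((isolated_iff C _).2 ⟨i, x', rfl, h0⟩)
    have hxv' : vcode C i x' ≠ vcode C i v' := fun e => hne (by rw [vcode_injective C i e])
    obtain ⟨c, hc, hc₃, hr, hd⟩ :=
      chainDist_exists_tight (vcode_valid C i x') (vcode_valid C i v') hxv'
    obtain ⟨y, rfl⟩ : ∃ y, vcode C i y = c := by
      by_cases h : c.2 = 3
      · exact ⟨v', (hc₃ h).symm⟩
      · exact exists_vcode C hc h
    have hvar : varRel C (Sum.inl ⟨i, x'⟩) (Sum.inl ⟨i, y⟩) ∨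
        varRel C (Sum.inl ⟨i, y⟩) (Sum.inl ⟨i, x'⟩) :=
      hr.elim (varRel_of_chainRel C h0) fun h => (varRel_of_chainRel C h0 h).symm
    have heq : dist₀ C (Sum.inl ⟨i, x'⟩) (Sum.inl ⟨i, v'⟩) =
        ωα C (Sum.inl ⟨i, x'⟩) (Sum.inl ⟨i, y⟩) + dist₀ C (Sum.inl ⟨i, y⟩) (Sum.inl ⟨i, v'⟩) := by
      rw [ωα_var C hvar]
      simp only [dist₀]
      rw [galphaDist_var C h0, galphaDist_var C h0]
      exact hd
    have hxy : (Sum.inl ⟨i, x'⟩ : GV C) ≠ Sum.inl ⟨i, y⟩ := by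
      intro e
      rw [ωα_var C hvar, ← e] at heq
      linarith
    exact ⟨_, (adj_iff C _ _).2 ⟨hxy, hvar.elim (fun h => Or.inl (Or.inl h))
      fun h => Or.inr (Or.inl (Or.inl h))⟩, rfl, heq⟩
  · obtain ⟨y, hw, hd⟩ := clauseDist_exists_tight x' v' fun e => hne (by rw [e])
    refine ⟨_, adj_clause C j hw, rfl, ?_⟩
    rw [ωα_clause C j hw]
    change (clauseDist₀ x' v' : ℝ) / 10 = clauseWeight₀ x' y / 10 + clauseDist₀ y v' / 10
    have : (clauseDist₀ x' v' : ℝ) = clauseWeight₀ x' y + clauseDist₀ y v' := by exact_mod_cast hd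
    linarith

variable {ψ} in
theorem dist_error (hψ : Satisfies C ψ) {x v : GV C} (hxv : gadget C x = gadget C v) :
    |dist₁ C ψ x v - dist₀ C x v| < 1 := by
  simp only [dist₀, dist₁]
  rcases gadget_eq_cases C hxv with ⟨i, x', v', rfl, rfl⟩ | ⟨j, x', v', rfl, rfl⟩
  · by_cases h0 : hocc C i = 0
    · rw [galphaDist_isolated C h0, galphaDist_isolated C h0, sub_self, abs_zero]
      exact one_pos
    · rw [galphaDist_var C h0, galphaDist_var C h0]
      exact chainDist_error (by exact_mod_cast (handleRound_mem (ψ i)).1)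
        (by exact_mod_cast (handleRound_mem (ψ i)).2) _ _
  · change |(clauseDist₁ (litValue C ψ j) x' v' : ℝ) - clauseDist₀ x' v' / 10| < 1
    obtain ⟨h₁, h₂⟩ := clauseDist_error _ (hψ j) x' v'
    have h₃ : 10 * (clauseDist₁ (litValue C ψ j) x' v' : ℝ) < clauseDist₀ x' v' + 10 := by
      exact_mod_cast h₁
    have h₄ : (clauseDist₀ x' v' : ℝ) < 10 * clauseDist₁ (litValue C ψ j) x' v' + 10 := by
      exact_mod_cast h₂
    rw [abs_lt]
    constructor <;> linarith

/-- The rounding error from a vertex of a variable gadget to the end of a clause-variable edge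
is `0` or the opposite of the rounding error of the handle at the other end of that edge. -/
theorem chainDist_error_port (i : Fin n) (k : Fin (hocc C i)) (y : VarV C i) :
    chainDist (handleRound (ψ i)) (vcode C i y) (vcode C i (port C i k)) -
      chainDist (5 / 2) (vcode C i y) (vcode C i (port C i k)) = 0 ∨
    chainDist (handleRound (ψ i)) (vcode C i y) (vcode C i (port C i k)) -
      chainDist (5 / 2) (vcode C i y) (vcode C i (port C i k)) =
      5 / 2 - handleRound (litValue C ψ ((occs C i).get k).1 ((occs C i).get k).2) := by
  have hi := literal_var C i k
  cases hk : (C ((occs C i).get k).1 ((occs C i).get k).2).2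
  · have hh : 5 / 2 - (handleRound (litValue C ψ ((occs C i).get k).1
        ((occs C i).get k).2) : ℝ) = handleRound (ψ i) - 5 / 2 := by
      rw [litValue, hk, hi]
      cases ψ i <;> norm_num [handleRound]
    rw [port_of_neg C hk, hh]
    exact chainDist_error_inverter _ _ _
  · have hh : litValue C ψ ((occs C i).get k).1 ((occs C i).get k).2 = ψ i := by
      rw [litValue, hk, hi]
      rfl
    rw [port_of_pos C hk, hh]
    refine chainDist_error_base _ _ _ fun h h₃ => ?_
    rcases y with ⟨l, s⟩ | (_ | _) | ⟨l, hl⟩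
    · exact absurd h₃ ((by decide : ∀ s : Fin 3, s.castSucc ≠ 3) s)
    · cases h₃
    · cases h₃
    · obtain rfl : l = k := Fin.ext (Nat.succ.inj h)
      rw [hk] at hl
      cases hl

variable {ψ} in
theorem dist_error_link (hψ : Satisfies C ψ) {p q x v : GV C} (h : Link C p q)
    (hx : gadget C x = gadget C p) (hv : gadget C v = gadget C q) :
    |(dist₁ C ψ x p - dist₀ C x p) + (dist₁ C ψ q v - dist₀ C q v)| < 1 := by
  have key : ∀ (i : Fin n) (k : Fin (hocc C i)) (y : VarV C i) (z : ClauseV) (e : ℝ),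
      e = (clauseDist₁ (litValue C ψ ((occs C i).get k).1)
          (Sum.inl (Sum.inr ((occs C i).get k).2)) z : ℝ) -
        clauseDist₀ (Sum.inl (Sum.inr ((occs C i).get k).2)) z / 10 →
      |(chainDist (handleRound (ψ i)) (vcode C i y) (vcode C i (port C i k)) -
        chainDist (5 / 2) (vcode C i y) (vcode C i (port C i k))) + e| < 1 := by
    rintro i k y z e rfl
    have hl := chainDist_error_port C ψ i k y
    generalize (occs C i).get k = q at hl ⊢
    obtain ⟨j, t⟩ := q
    obtain ⟨h₁, h₂⟩ := clauseDist_error (litValue C ψ j) (hψ j) (Sum.inl (Sum.inr t)) z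
    obtain ⟨h₃, h₄⟩ := clauseDist_error_knob (litValue C ψ j) (hψ j) t z
    dsimp only at hl ⊢
    rw [← Nat.cast_lt (α := ℝ)] at h₁ h₂ h₃ h₄
    push_cast at h₁ h₂ h₃ h₄
    rw [abs_lt]
    rcases hl with hl | hl <;> rw [hl] <;> constructor <;> linarith
  simp only [dist₀, dist₁]
  obtain ⟨i, k, y, z, ⟨rfl, rfl, rfl, rfl⟩ | ⟨rfl, rfl, rfl, rfl⟩⟩ := Link.cases_gadgets C h hx hv
  · rw [galphaDist_var C k.pos.ne', galphaDist_var C k.pos.ne', add_comm,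
      chainDist_comm _ _ (vcode C i y), chainDist_comm (5 / 2) _ (vcode C i y)]
    have hcomm := clauseDist_comm (litValue C ψ ((occs C i).get k).1) z
      (Sum.inl (Sum.inr ((occs C i).get k).2))
    exact key i k y z _ (congrArg₂ (fun a b : ℕ => (a : ℝ) - b / 10) hcomm.2 hcomm.1)
  · rw [galphaDist_var C k.pos.ne', galphaDist_var C k.pos.ne']
    exact key i k y z _ rfl

end Rounding

/-- If the 3-CNF formula `α` (with exactly three literals per clause and each variable
appearing at most once per clause) is satisfiable, then `G_α` admits a strong
`1`-rounding. -/
theorem satisfiable_implies_strong_one_rounding {n m : ℕ}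
    (C : Fin m → Fin 3 → Fin n × Bool) (hdist : DistinctVars C)
    (hsat : ∃ ψ : Fin n → Bool, Satisfies C ψ) :
    ∃ wt : GV C → GV C → ℕ, (∀ a b, wt a b = wt b a) ∧
      StrongRounding (Galpha C) (ωα C) wt 1 := by
  obtain ⟨ψ, hψ⟩ := hsat
  refine ⟨roundedWeight C ψ, roundedWeight_comm C ψ, ?_⟩
  refine (galpha_isGadgetGraph C hdist).strongRounding ?_ (isGadgetMetric_ωα C hdist hψ)
    (isGadgetMetric_roundedWeight C hdist hψ) ?_ (fun v x => exists_tight C)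
    (fun x v => dist_error C hψ) (fun p q x v => dist_error_link C hψ)
  · have : (0 : ℝ) ≤ m := Nat.cast_nonneg m
    linarith
  · intro x y hI hxy h
    obtain ⟨i, x', rfl, h0⟩ := (isolated_iff C x).1 hI
    rcases adj_same_cases C h hxy with ⟨i', x'', y', h₁, -, h0', -⟩ | ⟨_, _, _, h₁, -⟩
    · obtain rfl : i = i' := congrArg Sigma.fst (Sum.inl.inj h₁)
      exact h0' h0
    · cases h₁
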